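/- Let X be a set of 2n points in general position in the plane such that at most n+1 points of X are extreme points of the convex hull of X, and let H be a set of exactly n edges of X such that no non-crossing perfect matching of X avoids H. If {u,v} ∈ H is an edge whose endpoints u and v are both extreme points of the convex hull of X, then the segment uv is an edge of the boundary of the convex hull of X, i.e., u and v are consecutive vertices of the convex hull. -/

import Mathlib

open MeasureTheory Set Filter

noncomputable section

abbrev Pt : Type := ℝ × ℝ

/-- A finite point set is in general position: no three distinct points are collinear. -/
def GenPos (X : Finset Pt) : Prop :=
  ∀ a ∈ X, ∀ b ∈ X, ∀ c ∈ X, a ≠ b → a ≠ c → b ≠ c → ¬ Collinear ℝ ({a, b, c} : Set Pt)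

/-- `e` is an edge of `X`: an unordered pair of distinct points of `X`. -/
def IsEdgeOf (X : Finset Pt) (e : Sym2 Pt) : Prop :=
  ¬ e.IsDiag ∧ ∀ p ∈ e, p ∈ X

/-- The closed segment joining the two points of an unordered pair. -/
def edgeSeg (e : Sym2 Pt) : Set Pt :=
  Sym2.lift ⟨fun u v => segment ℝ u v, fun u v => segment_symm ℝ u v⟩ e

/-- `M` is a non-crossing perfect matching of `X`: a partition of `X` into unordered pairs
whose closed segments are pairwise disjoint. -/
def IsNCMatching (X : Finset Pt) (M : Finset (Sym2 Pt)) : Prop :=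
  (∀ e ∈ M, IsEdgeOf X e) ∧
  (∀ p ∈ X, ∃! e, e ∈ M ∧ p ∈ e) ∧
  (M : Set (Sym2 Pt)).Pairwise fun e f => Disjoint (edgeSeg e) (edgeSeg f)

/-- The matching `M` avoids the edge set `S`. -/
def Avoids (M S : Finset (Sym2 Pt)) : Prop := ∀ e ∈ M, e ∉ S

/-- The signed cross product determining on which side of the oriented line through `u` and `v`
the point `w` lies (`0 <` : left open half-plane, `< 0` : right open half-plane). -/
def cross (u v w : Pt) : ℝ :=
  (v.1 - u.1) * (w.2 - u.2) - (v.2 - u.2) * (w.1 - u.1)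

/-- Strict separation of two finite sets by a line. -/
def StrictSep (Y Z : Finset Pt) : Prop :=
  ∃ (c : Pt) (d : ℝ), (∀ w ∈ Y, c.1 * w.1 + c.2 * w.2 < d) ∧ ∀ w ∈ Z, d < c.1 * w.1 + c.2 * w.2

/-- `Y` has a non-crossing perfect matching avoiding `H`. -/
def Matchable (H : Finset (Sym2 Pt)) (Y : Finset Pt) : Prop :=
  ∃ M, IsNCMatching Y M ∧ Avoids M H

open Classical in
/-- The edges of `H` with both endpoints in `Y`. -/
def edgesIn (H : Finset (Sym2 Pt)) (Y : Finset Pt) : Finset (Sym2 Pt) :=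
  H.filter fun f => ∀ p ∈ f, p ∈ Y

/-- `x` is strictly separated by a linear functional from the other points of `Y`. -/
def IsExt (Y : Finset Pt) (x : Pt) : Prop :=
  x ∈ Y ∧ ∃ c : Pt, ∀ w ∈ Y, w ≠ x → 0 < c.1 * (w.1 - x.1) + c.2 * (w.2 - x.2)

/-- `a`, `b` are consecutive points on the boundary of the convex hull of `Y`,
in counterclockwise order. -/
def HullEdge (Y : Finset Pt) (a b : Pt) : Prop :=
  a ∈ Y ∧ b ∈ Y ∧ a ≠ b ∧ ∀ w ∈ Y, w ≠ a → w ≠ b → 0 < cross a b w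

theorem cross_swap (a b w : Pt) : cross b a w = -cross a b w := by
  unfold cross; ring

theorem cross_rotate (a b w : Pt) : cross b w a = cross a b w := by
  unfold cross; ring

theorem cross_swap_right (a b w : Pt) : cross a w b = -cross a b w := by
  unfold cross; ring

theorem cross_self_left (a b : Pt) : cross a b a = 0 := by
  unfold cross; ring

theorem cross_self_right (a b : Pt) : cross a b b = 0 := by
  unfold cross; ring

theorem GenPos.mono {X Y : Finset Pt} (h : GenPos X) (hYX : Y ⊆ X) : GenPos Y :=
  fun a ha b hb c hc => h a (hYX ha) b (hYX hb) c (hYX hc)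

theorem GenPos.cross_ne_zero {X : Finset Pt} (h : GenPos X) {a b c : Pt} (ha : a ∈ X)
    (hb : b ∈ X) (hc : c ∈ X) (hab : a ≠ b) (hac : a ≠ c) (hbc : b ≠ c) : cross a b c ≠ 0 := by
  intro h0
  apply h a ha b hb c hc hab hac hbc
  rw [collinear_iff_of_mem (p₀ := a) (by simp)]
  refine ⟨b - a, ?_⟩
  unfold cross at h0
  intro p hp
  simp only [Set.mem_insert_iff, Set.mem_singleton_iff] at hp
  rcases hp with rfl | rfl | rfl
  · exact ⟨0, by simp⟩
  · exact ⟨1, by simp⟩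
  · by_cases hx : b.1 - a.1 = 0
    · have hy : b.2 - a.2 ≠ 0 := by
        intro hy
        exact hab (Prod.ext (by linarith) (by linarith))
      refine ⟨(p.2 - a.2) / (b.2 - a.2), ?_⟩
      have : p.1 - a.1 = 0 := by
        rw [hx] at h0
        have : (b.2 - a.2) * (p.1 - a.1) = 0 := by linarith
        exact (mul_eq_zero.mp this).resolve_left hy
      ext
      · simp [hx]; linarith
      · simp; field_simp; ring
    · refine ⟨(p.1 - a.1) / (b.1 - a.1), ?_⟩
      ext
      · simp; field_simp; ring
      · simp; field_simp; linarith

theorem StrictSep.disjoint {Y Z : Finset Pt} (h : StrictSep Y Z) {w : Pt} (hY : w ∈ Y)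
    (hZ : w ∈ Z) : False := by
  obtain ⟨c, d, h1, h2⟩ := h
  exact lt_asymm (h1 w hY) (h2 w hZ)

/-- Two sets lying weakly on different sides of a line through two points, sharing none of these
points, are strictly separated: tilt the line. -/
theorem strictSep_of_cross {Y Z : Finset Pt} {x y : Pt} (hxy : x ≠ y)
    (hY : ∀ w ∈ Y, cross x y w < 0 ∨ w = x ∨ w = y)
    (hZ : ∀ w ∈ Z, 0 < cross x y w ∨ w = x ∨ w = y) (hd : ∀ w ∈ Y, w ∉ Z) : StrictSep Y Z := by
  classical
  obtain ⟨sx, hsx⟩ : ∃ s : ℝ, (x ∈ Y → s < 0) ∧ (x ∈ Z → 0 < s) := by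
    by_cases h : x ∈ Y
    · exact ⟨-1, fun _ => by norm_num, fun h' => absurd h' (hd x h)⟩
    · exact ⟨1, fun h' => absurd h' h, fun _ => by norm_num⟩
  obtain ⟨sy, hsy⟩ : ∃ s : ℝ, (y ∈ Y → s < 0) ∧ (y ∈ Z → 0 < s) := by
    by_cases h : y ∈ Y
    · exact ⟨-1, fun _ => by norm_num, fun h' => absurd h' (hd y h)⟩
    · exact ⟨1, fun h' => absurd h' h, fun _ => by norm_num⟩
  have hD : 0 < (y.1 - x.1) ^ 2 + (y.2 - x.2) ^ 2 := by
    by_contra hcon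
    have h1 : (y.1 - x.1) = 0 := by nlinarith [sq_nonneg (y.1 - x.1), sq_nonneg (y.2 - x.2)]
    have h2 : (y.2 - x.2) = 0 := by nlinarith [sq_nonneg (y.1 - x.1), sq_nonneg (y.2 - x.2)]
    exact hxy (Prod.ext (by linarith) (by linarith))
  set D := (y.1 - x.1) ^ 2 + (y.2 - x.2) ^ 2 with hDdef
  set β := (sy - sx) / D with hβ
  let l : Pt → ℝ := fun w => sx + β * ((w.1 - x.1) * (y.1 - x.1) + (w.2 - x.2) * (y.2 - x.2))
  have hlx : l x = sx := by simp [l]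
  have hly : l y = sy := by
    have : (y.1 - x.1) * (y.1 - x.1) + (y.2 - x.2) * (y.2 - x.2) = D := by rw [hDdef]; ring
    simp only [l, this, hβ]
    field_simp
    ring
  have hlim : ∀ w : Pt, Tendsto (fun ε : ℝ => cross x y w + ε * l w) (nhdsWithin 0 (Set.Ioi 0))
      (nhds (cross x y w)) := by
    intro w
    have : Continuous (fun ε : ℝ => cross x y w + ε * l w) := by fun_prop
    have h := (this.tendsto 0).mono_left (nhdsWithin_le_nhds (s := Set.Ioi 0))
    simpa using h
  have hpos : ∀ᶠ ε : ℝ in nhdsWithin 0 (Set.Ioi 0), 0 < ε := eventually_mem_nhdsWithin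
  have e1 : ∀ᶠ ε : ℝ in nhdsWithin 0 (Set.Ioi 0), ∀ w ∈ Y, cross x y w + ε * l w < 0 := by
    rw [Filter.eventually_all_finset]
    intro w hw
    rcases hY w hw with h | rfl | rfl
    · exact (hlim w).eventually (gt_mem_nhds h)
    · filter_upwards [hpos] with ε hε
      rw [cross_self_left, hlx]
      nlinarith [hsx.1 hw]
    · filter_upwards [hpos] with ε hε
      rw [cross_self_right, hly]
      nlinarith [hsy.1 hw]
  have e2 : ∀ᶠ ε : ℝ in nhdsWithin 0 (Set.Ioi 0), ∀ w ∈ Z, 0 < cross x y w + ε * l w := by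
    rw [Filter.eventually_all_finset]
    intro w hw
    rcases hZ w hw with h | rfl | rfl
    · exact (hlim w).eventually (lt_mem_nhds h)
    · filter_upwards [hpos] with ε hε
      rw [cross_self_left, hlx]
      nlinarith [mul_pos hε (hsx.2 hw)]
    · filter_upwards [hpos] with ε hε
      rw [cross_self_right, hly]
      nlinarith [mul_pos hε (hsy.2 hw)]
  obtain ⟨ε, h1, h2⟩ := (e1.and e2).exists
  refine ⟨(-(y.2 - x.2) + ε * β * (y.1 - x.1), (y.1 - x.1) + ε * β * (y.2 - x.2)),
    -((y.2 - x.2) * x.1 - (y.1 - x.1) * x.2 + ε * sx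
      - ε * β * (x.1 * (y.1 - x.1) + x.2 * (y.2 - x.2))), ?_, ?_⟩
  · intro w hw
    have := h1 w hw
    simp only [l, cross] at this ⊢
    nlinarith
  · intro w hw
    have := h2 w hw
    simp only [l, cross] at this ⊢
    nlinarith

theorem segment_sep {c a b : Pt} {d : ℝ} (ha : c.1 * a.1 + c.2 * a.2 < d)
    (hb : c.1 * b.1 + c.2 * b.2 < d) {z : Pt} (hz : z ∈ segment ℝ a b) :
    c.1 * z.1 + c.2 * z.2 < d := by
  obtain ⟨s, t, hs, ht, hst, rfl⟩ := hz
  simp only [Prod.fst_add, Prod.smul_fst, Prod.snd_add, Prod.smul_snd, smul_eq_mul]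
  have e : c.1 * (s * a.1 + t * b.1) + c.2 * (s * a.2 + t * b.2)
      = s * (c.1 * a.1 + c.2 * a.2) + t * (c.1 * b.1 + c.2 * b.2) := by ring
  rw [e]
  have hd : d = s * d + t * d := by rw [← add_mul, hst, one_mul]
  rcases hs.eq_or_lt with h | h
  · have : t = 1 := by linarith
    subst this; subst h; simpa using hb
  · nlinarith [mul_lt_mul_of_pos_left ha h, mul_le_mul_of_nonneg_left hb.le ht]

theorem edgeSeg_disjoint_of_sep {Y Z : Finset Pt} (h : StrictSep Y Z) {e f : Sym2 Pt}
    (he : ∀ p ∈ e, p ∈ Y) (hf : ∀ p ∈ f, p ∈ Z) : Disjoint (edgeSeg e) (edgeSeg f) := by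
  obtain ⟨c, d, h1, h2⟩ := h
  induction e with | _ a b
  induction f with | _ a' b'
  rw [Set.disjoint_left]
  intro z hz hz'
  change z ∈ segment ℝ a b at hz
  change z ∈ segment ℝ a' b' at hz'
  have k1 := segment_sep (h1 a (he a (by simp))) (h1 b (he b (by simp))) hz
  have k2 := segment_sep (c := -c) (d := -d) (a := a') (b := b')
    (by have := h2 a' (hf a' (by simp)); simp; linarith)
    (by have := h2 b' (hf b' (by simp)); simp; linarith) hz'
  simp at k2
  linarith

open Classical in
theorem Matchable.union {H : Finset (Sym2 Pt)} {Y Z : Finset Pt} (hY : Matchable H Y)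
    (hZ : Matchable H Z) (h : StrictSep Y Z) : Matchable H (Y ∪ Z) := by
  obtain ⟨M, ⟨hM1, hM2, hM3⟩, hM4⟩ := hY
  obtain ⟨N, ⟨hN1, hN2, hN3⟩, hN4⟩ := hZ
  refine ⟨M ∪ N, ⟨?_, ?_, ?_⟩, ?_⟩
  · intro e he
    rcases Finset.mem_union.mp he with he | he
    · exact ⟨(hM1 e he).1, fun p hp => Finset.mem_union_left _ ((hM1 e he).2 p hp)⟩
    · exact ⟨(hN1 e he).1, fun p hp => Finset.mem_union_right _ ((hN1 e he).2 p hp)⟩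
  · intro p hp
    rcases Finset.mem_union.mp hp with hp | hp
    · obtain ⟨e, ⟨he, hpe⟩, hu⟩ := hM2 p hp
      refine ⟨e, ⟨Finset.mem_union_left _ he, hpe⟩, ?_⟩
      rintro f ⟨hf, hpf⟩
      rcases Finset.mem_union.mp hf with hf | hf
      · exact hu f ⟨hf, hpf⟩
      · exact (h.disjoint hp ((hN1 f hf).2 p hpf)).elim
    · obtain ⟨e, ⟨he, hpe⟩, hu⟩ := hN2 p hp
      refine ⟨e, ⟨Finset.mem_union_right _ he, hpe⟩, ?_⟩
      rintro f ⟨hf, hpf⟩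
      rcases Finset.mem_union.mp hf with hf | hf
      · exact (h.disjoint ((hM1 f hf).2 p hpf) hp).elim
      · exact hu f ⟨hf, hpf⟩
  · intro e he f hf hef
    rw [Finset.mem_coe, Finset.mem_union] at he hf
    rcases he with he | he <;> rcases hf with hf | hf
    · exact hM3 he hf hef
    · exact edgeSeg_disjoint_of_sep h (hM1 e he).2 (hN1 f hf).2
    · exact (edgeSeg_disjoint_of_sep h (hM1 f hf).2 (hN1 e he).2).symm
    · exact hN3 he hf hef
  · intro e he
    rcases Finset.mem_union.mp he with he | he
    · exact hM4 e he
    · exact hN4 e he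

theorem matchable_empty (H : Finset (Sym2 Pt)) : Matchable H ∅ :=
  ⟨∅, ⟨by simp, by simp, by simp⟩, by intro e he; simp at he⟩

open Classical in
theorem matchable_pair {H : Finset (Sym2 Pt)} {a b : Pt} (hab : a ≠ b) (h : s(a, b) ∉ H) :
    Matchable H {a, b} := by
  refine ⟨{s(a, b)}, ⟨?_, ?_, by simp⟩, ?_⟩
  · intro e he
    rw [Finset.mem_singleton] at he
    subst he
    exact ⟨by simpa using hab, by simp⟩
  · intro p hp
    refine ⟨s(a, b), ⟨by simp, by simpa using hp⟩, ?_⟩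
    rintro f ⟨hf, -⟩
    simpa using hf
  · intro e he
    rw [Finset.mem_singleton] at he
    subst he
    exact h

theorem mem_edgesIn {H : Finset (Sym2 Pt)} {Y : Finset Pt} {f : Sym2 Pt} :
    f ∈ edgesIn H Y ↔ f ∈ H ∧ ∀ p ∈ f, p ∈ Y := by
  classical
  exact Finset.mem_filter

theorem edgesIn_mono {H : Finset (Sym2 Pt)} {Y Z : Finset Pt} (h : Y ⊆ Z) :
    edgesIn H Y ⊆ edgesIn H Z := by
  intro f hf
  rw [mem_edgesIn] at hf ⊢
  exact ⟨hf.1, fun p hp => h (hf.2 p hp)⟩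

theorem IsExt.mono {Y Z : Finset Pt} {x : Pt} (h : IsExt Z x) (hYZ : Y ⊆ Z) (hx : x ∈ Y) :
    IsExt Y x := by
  obtain ⟨-, c, hc⟩ := h
  exact ⟨hx, c, fun w hw => hc w (hYZ hw)⟩

theorem exists_isExt {Y : Finset Pt} (hY : Y.Nonempty) : ∃ x, IsExt Y x := by
  obtain ⟨x, hx, hmax⟩ := Y.exists_max_image (fun w => w.1 ^ 2 + w.2 ^ 2) hY
  refine ⟨x, hx, -x, fun w hw hne => ?_⟩
  have h := hmax w hw
  simp only [Prod.fst_neg, Prod.snd_neg] at h ⊢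
  have : 0 < (w.1 - x.1) ^ 2 + (w.2 - x.2) ^ 2 := by
    by_contra hcon
    have h1 : (w.1 - x.1) = 0 := by nlinarith [sq_nonneg (w.1 - x.1), sq_nonneg (w.2 - x.2)]
    have h2 : (w.2 - x.2) = 0 := by nlinarith [sq_nonneg (w.1 - x.1), sq_nonneg (w.2 - x.2)]
    exact hne (Prod.ext (by linarith) (by linarith))
  nlinarith

theorem isExt_of_strictSep {Y Z : Finset Pt} {x : Pt} (hx : x ∈ Y) (hZ : ∀ w ∈ Y, w ≠ x → w ∈ Z)
    (h : StrictSep {x} Z) : IsExt Y x := by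
  obtain ⟨c, d, h1, h2⟩ := h
  refine ⟨hx, c, fun w hw hne => ?_⟩
  have := h1 x (by simp)
  have := h2 w (hZ w hw hne)
  linarith

open Classical in
theorem HullEdge.isExt_left {Y : Finset Pt} {a b : Pt} (h : HullEdge Y a b) : IsExt Y a := by
  obtain ⟨ha, hb, hab, hw⟩ := h
  refine isExt_of_strictSep (Z := Y.erase a) ha (by simp +contextual) ?_
  refine strictSep_of_cross hab (by simp) ?_ (by simp)
  intro w hwY
  rw [Finset.mem_erase] at hwY
  by_cases h : w = b
  · simp [h]
  · exact Or.inl (hw w hwY.2 hwY.1 h)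

open Classical in
theorem HullEdge.isExt_right {Y : Finset Pt} {a b : Pt} (h : HullEdge Y a b) : IsExt Y b := by
  obtain ⟨ha, hb, hab, hw⟩ := h
  refine isExt_of_strictSep (Z := Y.erase b) hb (by simp +contextual) ?_
  refine strictSep_of_cross hab (by simp) ?_ (by simp)
  intro w hwY
  rw [Finset.mem_erase] at hwY
  by_cases h : w = a
  · simp [h]
  · exact Or.inl (hw w hwY.2 h hwY.1)

open Classical in
theorem HullEdge.matchable {H : Finset (Sym2 Pt)} {Y : Finset Pt} {a b : Pt} (h : HullEdge Y a b)
    (hab : s(a, b) ∉ H) (hm : Matchable H ((Y.erase a).erase b)) : Matchable H Y := by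
  obtain ⟨ha, hb, hne, hw⟩ := h
  have hs : StrictSep {a, b} ((Y.erase a).erase b) := by
    refine strictSep_of_cross hne (by simp) ?_ (by simp)
    intro w hwY
    simp only [Finset.mem_erase] at hwY
    exact Or.inl (hw w hwY.2.2 hwY.2.1 hwY.1)
  have := (matchable_pair hne hab).union hm hs
  convert this using 1
  ext w
  simp only [Finset.mem_union, Finset.mem_insert, Finset.mem_singleton, Finset.mem_erase]
  by_cases h1 : w = a
  · simp [h1, ha]
  · by_cases h2 : w = b
    · simp [h2, hb]
    · simp [h1, h2]

theorem exists_monotone_enumeration {α : Type*} [DecidableEq α] (S : Finset α) (κ : α → ℝ)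
    (hκ : Set.InjOn κ S) (z : α) : ∃ q : ℕ → α, (∀ w, w ∈ S ↔ ∃ i < S.card, q i = w) ∧
      ∀ i j, i < j → j < S.card → κ (q i) < κ (q j) := by
  have hc : (S.image κ).card = S.card := Finset.card_image_of_injOn hκ
  let e := (S.image κ).orderEmbOfFin hc
  have he : ∀ i, ∃ w ∈ S, κ w = e i := fun i =>
    Finset.mem_image.mp (Finset.orderEmbOfFin_mem _ hc i)
  choose r hrS hr using he
  have hr' : ∀ w ∈ S, ∃ i, r i = w := by
    intro w hw
    have : κ w ∈ Set.range e := by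
      rw [Finset.range_orderEmbOfFin]
      exact Finset.mem_coe.mpr (Finset.mem_image_of_mem κ hw)
    obtain ⟨i, hi⟩ := this
    exact ⟨i, hκ (hrS i) hw ((hr i).trans hi)⟩
  refine ⟨fun i => if h : i < S.card then r ⟨i, h⟩ else z, ?_, ?_⟩
  · intro w
    constructor
    · intro hw
      obtain ⟨i, hi⟩ := hr' w hw
      exact ⟨i, i.2, by simpa using hi⟩
    · rintro ⟨i, hi, rfl⟩
      simpa [hi] using hrS ⟨i, hi⟩
  · intro i j hij hj
    have hi := hij.trans hj
    simp only [hi, hj, dif_pos, hr]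
    exact e.strictMono (by simpa using hij)

/-- `q` lists the points of `Y` other than the extreme point `x` in counterclockwise order
around `x`. -/
structure Radial (Y : Finset Pt) (x : Pt) (N : ℕ) (q : ℕ → Pt) : Prop where
  ext : IsExt Y x
  mem_iff : ∀ w, w ∈ Y ↔ w = x ∨ ∃ i < N, q i = w
  ne : ∀ i < N, q i ≠ x
  pos : ∀ i j, i < j → j < N → 0 < cross x (q i) (q j)

theorem IsExt.exists_radial {Y : Finset Pt} {x : Pt} (h : IsExt Y x) (hgp : GenPos Y) {N : ℕ}
    (hN : Y.card = N + 1) : ∃ q, Radial Y x N q := by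
  obtain ⟨hx, c, hc⟩ := h
  let g : Pt → ℝ := fun w => c.1 * (w.1 - x.1) + c.2 * (w.2 - x.2)
  let p : Pt → ℝ := fun w => -c.2 * (w.1 - x.1) + c.1 * (w.2 - x.2)
  have key : ∀ a b, (c.1 ^ 2 + c.2 ^ 2) * cross x a b = g a * p b - p a * g b := by
    intro a b; simp only [g, p, cross]; ring
  have hcpos : ∀ w ∈ Y.erase x, 0 < c.1 ^ 2 + c.2 ^ 2 := by
    intro w hw
    rw [Finset.mem_erase] at hw
    have := hc w hw.2 hw.1
    by_contra hcon
    have h1 : c.1 = 0 := by nlinarith [sq_nonneg c.1, sq_nonneg c.2]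
    have h2 : c.2 = 0 := by nlinarith [sq_nonneg c.1, sq_nonneg c.2]
    simp [h1, h2] at this
  have hg : ∀ w ∈ Y.erase x, 0 < g w := by
    intro w hw
    rw [Finset.mem_erase] at hw
    exact hc w hw.2 hw.1
  have hinj : Set.InjOn (fun w => p w / g w) (Y.erase x) := by
    intro a ha b hb hab
    by_contra hne
    have h1 := hg a ha
    have h2 := hg b hb
    simp only at hab
    rw [div_eq_div_iff h1.ne' h2.ne'] at hab
    have h3 := key a b
    have h4 : (c.1 ^ 2 + c.2 ^ 2) * cross x a b = 0 := by rw [h3]; linarith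
    have ha' := Finset.mem_erase.mp (Finset.mem_coe.mp ha)
    have hb' := Finset.mem_erase.mp (Finset.mem_coe.mp hb)
    rcases mul_eq_zero.mp h4 with h5 | h5
    · exact (hcpos a ha).ne' h5
    · exact hgp.cross_ne_zero hx ha'.2 hb'.2 ha'.1.symm hb'.1.symm hne h5
  obtain ⟨q, hq1, hq2⟩ := exists_monotone_enumeration (Y.erase x) _ hinj x
  have hcard : (Y.erase x).card = N := by rw [Finset.card_erase_of_mem hx, hN]; rfl
  rw [hcard] at hq1 hq2
  have hmem : ∀ i < N, q i ∈ Y.erase x := fun i hi => (hq1 _).mpr ⟨i, hi, rfl⟩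
  refine ⟨q, ⟨hx, c, hc⟩, ?_, fun i hi => (Finset.mem_erase.mp (hmem i hi)).1, ?_⟩
  · intro w
    rw [← hq1, Finset.mem_erase]
    by_cases h : w = x
    · simp [h, hx]
    · simp [h]
  · intro i j hij hj
    have h1 := hmem i (hij.trans hj)
    have h2 := hmem j hj
    have h3 := hq2 i j hij hj
    rw [div_lt_div_iff₀ (hg _ h1) (hg _ h2)] at h3
    have h4 := key (q i) (q j)
    have h5 : 0 < (c.1 ^ 2 + c.2 ^ 2) * cross x (q i) (q j) := by rw [h4]; linarith
    exact (mul_pos_iff_of_pos_left (hcpos _ h1)).mp h5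

/-- The points `q i`, …, `q (j - 1)`. -/
def arc (q : ℕ → Pt) (i j : ℕ) : Finset Pt := (Finset.Ico i j).image q

theorem mem_arc {q : ℕ → Pt} {i j : ℕ} {w : Pt} :
    w ∈ arc q i j ↔ ∃ k, i ≤ k ∧ k < j ∧ q k = w := by
  simp [arc, and_assoc]

theorem arc_mono {q : ℕ → Pt} {i j i' j' : ℕ} (hi : i' ≤ i) (hj : j ≤ j') :
    arc q i j ⊆ arc q i' j' :=
  Finset.image_subset_image (Finset.Ico_subset_Ico hi hj)

theorem card_edgesIn_add_le {H : Finset (Sym2 Pt)} {F : Finset (Sym2 Pt)} {S T : Finset Pt}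
    (hS : edgesIn H S ⊆ F) (hT : edgesIn H T ⊆ F) (hST : Disjoint (edgesIn H S) (edgesIn H T)) :
    (edgesIn H S).card + (edgesIn H T).card ≤ F.card := by
  classical
  rw [← Finset.card_union_of_disjoint hST]
  exact Finset.card_le_card (Finset.union_subset hS hT)

theorem edgesIn_disjoint {H : Finset (Sym2 Pt)} (hH : ∀ e ∈ H, ¬ e.IsDiag) {S T : Finset Pt}
    {z : Pt} (h : ∀ w ∈ S, w ∈ T → w = z) : Disjoint (edgesIn H S) (edgesIn H T) := by
  rw [Finset.disjoint_left]
  intro f hf hf'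
  rw [mem_edgesIn] at hf hf'
  induction f with | _ a b
  apply hH _ hf.1
  have h1 := h a (hf.2 a (by simp)) (hf'.2 a (by simp))
  have h2 := h b (hf.2 b (by simp)) (hf'.2 b (by simp))
  rw [h1, h2]
  simp

namespace Radial

variable {H : Finset (Sym2 Pt)} {Y : Finset Pt} {x : Pt} {N : ℕ} {q : ℕ → Pt}

theorem mem (h : Radial Y x N q) {i : ℕ} (hi : i < N) : q i ∈ Y :=
  (h.mem_iff _).mpr (Or.inr ⟨i, hi, rfl⟩)

theorem x_mem (h : Radial Y x N q) : x ∈ Y := h.ext.1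

theorem lt_of_cross_pos (h : Radial Y x N q) {i j : ℕ} (hi : i < N)
    (hc : 0 < cross x (q i) (q j)) : i < j := by
  by_contra! hij
  rcases hij.eq_or_lt with rfl | hij
  · rw [cross_self_right] at hc; exact hc.false
  · have := h.pos j i hij hi
    rw [cross_swap_right] at this
    linarith

theorem neg (h : Radial Y x N q) {i j : ℕ} (hij : j < i) (hi : i < N) :
    cross x (q i) (q j) < 0 := by
  have := h.pos j i hij hi
  rw [cross_swap_right] at this
  linarith

theorem inj (h : Radial Y x N q) {i j : ℕ} (hi : i < N) (hj : j < N) (hq : q i = q j) :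
    i = j := by
  rcases lt_trichotomy i j with hij | hij | hij
  · have := h.pos i j hij hj
    rw [hq, cross_self_right] at this
    exact this.false.elim
  · exact hij
  · have := h.pos j i hij hi
    rw [hq, cross_self_right] at this
    exact this.false.elim

theorem mem_arc_iff (h : Radial Y x N q) {i j k : ℕ} (hk : k < N) (hj : j ≤ N) :
    q k ∈ arc q i j ↔ i ≤ k ∧ k < j := by
  rw [mem_arc]
  constructor
  · rintro ⟨l, h1, h2, h3⟩
    rw [h.inj (h2.trans_le hj) hk h3] at h1 h2
    exact ⟨h1, h2⟩
  · rintro ⟨h1, h2⟩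
    exact ⟨k, h1, h2, rfl⟩

theorem x_notMem_arc (h : Radial Y x N q) {i j : ℕ} (hj : j ≤ N) : x ∉ arc q i j := by
  rw [mem_arc]
  rintro ⟨k, -, hk, hkx⟩
  exact h.ne k (hk.trans_le hj) hkx

theorem arc_subset (h : Radial Y x N q) {i j : ℕ} (hj : j ≤ N) : arc q i j ⊆ Y := by
  intro w hw
  obtain ⟨k, -, hk, rfl⟩ := mem_arc.mp hw
  exact h.mem (hk.trans_le hj)

theorem card_arc (h : Radial Y x N q) {i j : ℕ} (hj : j ≤ N) : (arc q i j).card = j - i := by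
  rw [arc, Finset.card_image_of_injOn, Nat.card_Ico]
  intro a ha b hb hab
  simp only [Finset.coe_Ico, Set.mem_Ico] at ha hb
  exact h.inj (ha.2.trans_le hj) (hb.2.trans_le hj) hab

theorem edgesIn_arc_disjoint (h : Radial Y x N q) (hH : ∀ e ∈ H, ¬ e.IsDiag) {i j i' j' : ℕ}
    (hj' : j' ≤ N) (hji : j ≤ i' + 1) (hj : j ≤ N) :
    Disjoint (edgesIn H (arc q i j)) (edgesIn H (arc q i' j')) := by
  apply edgesIn_disjoint hH (z := q i')
  intro w hw hw'
  obtain ⟨k, -, hk, rfl⟩ := mem_arc.mp hw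
  rw [h.mem_arc_iff (hk.trans_le hj) hj'] at hw'
  congr 1
  lia

theorem strictSep_arc_insert (h : Radial Y x N q) {i : ℕ} (hi : i < N) :
    StrictSep (arc q 0 i) (insert x (arc q i N)) := by
  refine strictSep_of_cross (h.ne i hi).symm ?_ ?_ ?_
  · intro w hw
    obtain ⟨k, -, hk, rfl⟩ := mem_arc.mp hw
    exact Or.inl (h.neg hk hi)
  · intro w hw
    rw [Finset.mem_insert] at hw
    rcases hw with rfl | hw
    · exact Or.inr (Or.inl rfl)
    · obtain ⟨k, hk, hk', rfl⟩ := mem_arc.mp hw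
      rcases hk.eq_or_lt with rfl | hk
      · exact Or.inr (Or.inr rfl)
      · exact Or.inl (h.pos _ _ hk hk')
  · intro w hw hw'
    rw [Finset.mem_insert] at hw'
    rcases hw' with rfl | hw'
    · exact h.x_notMem_arc hi.le hw
    · obtain ⟨k, -, hk, rfl⟩ := mem_arc.mp hw
      rw [h.mem_arc_iff (hk.trans hi) le_rfl] at hw'
      lia

theorem strictSep_insert_arc (h : Radial Y x N q) {i : ℕ} (hi : i < N) :
    StrictSep (insert x (arc q 0 i)) (arc q i N) := by
  refine strictSep_of_cross (h.ne i hi).symm ?_ ?_ ?_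
  · intro w hw
    rw [Finset.mem_insert] at hw
    rcases hw with rfl | hw
    · exact Or.inr (Or.inl rfl)
    · obtain ⟨k, -, hk, rfl⟩ := mem_arc.mp hw
      exact Or.inl (h.neg hk hi)
  · intro w hw
    obtain ⟨k, hk, hk', rfl⟩ := mem_arc.mp hw
    rcases hk.eq_or_lt with rfl | hk
    · exact Or.inr (Or.inr rfl)
    · exact Or.inl (h.pos _ _ hk hk')
  · intro w hw hw'
    rw [Finset.mem_insert] at hw
    rcases hw with rfl | hw
    · exact h.x_notMem_arc le_rfl hw'
    · obtain ⟨k, -, hk, rfl⟩ := mem_arc.mp hw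
      rw [h.mem_arc_iff (hk.trans hi) le_rfl] at hw'
      lia

theorem matchable_of_arc_insert (h : Radial Y x N q) {i : ℕ} (hi : i < N)
    (h1 : Matchable H (arc q 0 i)) (h2 : Matchable H (insert x (arc q i N))) :
    Matchable H Y := by
  convert h1.union h2 (h.strictSep_arc_insert hi) using 1
  ext w
  rw [h.mem_iff, Finset.mem_union, Finset.mem_insert, mem_arc, mem_arc]
  constructor
  · rintro (rfl | ⟨k, hk, rfl⟩)
    · simp
    · rcases lt_or_ge k i with h | h
      · exact Or.inl ⟨k, by lia, h, rfl⟩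
      · exact Or.inr (Or.inr ⟨k, h, hk, rfl⟩)
  · rintro (⟨k, -, hk, rfl⟩ | rfl | ⟨k, -, hk, rfl⟩)
    · exact Or.inr ⟨k, by lia, rfl⟩
    · simp
    · exact Or.inr ⟨k, by lia, rfl⟩

theorem matchable_of_insert_arc (h : Radial Y x N q) {i : ℕ} (hi : i < N)
    (h1 : Matchable H (insert x (arc q 0 i))) (h2 : Matchable H (arc q i N)) :
    Matchable H Y := by
  convert h1.union h2 (h.strictSep_insert_arc hi) using 1
  ext w
  rw [h.mem_iff, Finset.mem_union, Finset.mem_insert, mem_arc, mem_arc]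
  constructor
  · rintro (rfl | ⟨k, hk, rfl⟩)
    · simp
    · rcases lt_or_ge k i with h | h
      · exact Or.inl (Or.inr ⟨k, by lia, h, rfl⟩)
      · exact Or.inr ⟨k, h, hk, rfl⟩
  · rintro ((rfl | ⟨k, -, hk, rfl⟩) | ⟨k, -, hk, rfl⟩)
    · simp
    · exact Or.inr ⟨k, by lia, rfl⟩
    · exact Or.inr ⟨k, by lia, rfl⟩

theorem hullEdge_zero (h : Radial Y x N q) (hN : 0 < N) : HullEdge Y x (q 0) := by
  refine ⟨h.x_mem, h.mem hN, (h.ne 0 hN).symm, fun w hw hwx hw0 => ?_⟩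
  obtain rfl | ⟨k, hk, rfl⟩ := (h.mem_iff w).mp hw
  · exact absurd rfl hwx
  · have : k ≠ 0 := by rintro rfl; exact hw0 rfl
    exact h.pos 0 k (by lia) hk

theorem hullEdge_last (h : Radial Y x (N + 1) q) : HullEdge Y (q N) x := by
  refine ⟨h.mem (by lia), h.x_mem, h.ne N (by lia), fun w hw hw0 hwx => ?_⟩
  obtain rfl | ⟨k, hk, rfl⟩ := (h.mem_iff w).mp hw
  · exact absurd rfl hwx
  · have : k ≠ N := by rintro rfl; exact hw0 rfl
    rw [cross_swap]
    have := h.neg (i := N) (j := k) (by lia) (by lia)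
    linarith

theorem matchable_of_pair (h : Radial Y x N q) {i : ℕ} (hi : i < N) (hH : s(x, q i) ∉ H)
    (h1 : Matchable H (arc q 0 i)) (h2 : Matchable H (arc q (i + 1) N)) :
    Matchable H Y := by
  refine h.matchable_of_arc_insert hi h1 ?_
  have hsub : insert x (arc q i N) ⊆ Y := by
    rw [Finset.insert_subset_iff]
    exact ⟨h.x_mem, h.arc_subset le_rfl⟩
  have hqi : q i ∈ arc q i N := (h.mem_arc_iff hi le_rfl).mpr ⟨le_rfl, hi⟩
  have he : HullEdge (insert x (arc q i N)) x (q i) := by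
    refine ⟨by simp, by simp [hqi], (h.ne i hi).symm, fun w hw hwx hwi => ?_⟩
    rw [Finset.mem_insert] at hw
    rcases hw with rfl | hw
    · exact absurd rfl hwx
    · obtain ⟨k, hk, hk', rfl⟩ := mem_arc.mp hw
      have : k ≠ i := by rintro rfl; exact hwi rfl
      exact h.pos i k (by lia) hk'
  refine he.matchable hH ?_
  convert h2 using 1
  ext w
  simp only [Finset.mem_erase, Finset.mem_insert]
  constructor
  · rintro ⟨h1, h2, h3 | h3⟩
    · exact absurd h3 h2
    · obtain ⟨k, hk, hk', rfl⟩ := mem_arc.mp h3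
      have : k ≠ i := by rintro rfl; exact h1 rfl
      exact (h.mem_arc_iff hk' le_rfl).mpr ⟨by lia, hk'⟩
  · intro hw
    obtain ⟨k, hk, hk', rfl⟩ := mem_arc.mp hw
    refine ⟨fun he => ?_, h.ne k hk', Or.inr ((h.mem_arc_iff hk' le_rfl).mpr ⟨by lia, hk'⟩)⟩
    have := h.inj hk' hi he
    lia

theorem card_eq (h : Radial Y x N q) : Y.card = N + 1 := by
  have : Y = insert x (arc q 0 N) := by
    ext w
    rw [h.mem_iff, Finset.mem_insert, mem_arc]
    simp
  rw [this, Finset.card_insert_of_notMem (h.x_notMem_arc le_rfl), h.card_arc le_rfl]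
  rfl

end Radial

/-- The form of the edges of a non-matchable set around an extreme point `x` both of whose
hull edges belong to `H`. -/
structure Fan (H : Finset (Sym2 Pt)) (Y : Finset Pt) (x : Pt) (M : ℕ) (q : ℕ → Pt)
    (k k' : ℕ) : Prop where
  radial : Radial Y x (2 * M + 1) q
  lt : k < k'
  le : k' ≤ M
  card : (edgesIn H Y).card = M + 1
  card_left : (edgesIn H (arc q 0 (2 * k))).card = k
  card_right : (edgesIn H (arc q (2 * k' + 1) (2 * M + 1))).card = M - k'
  mem_zero : s(x, q 0) ∈ H
  mem_last : s(x, q (2 * M)) ∈ H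
  mem_mid : ∀ j, k < j → j < k' → s(x, q (2 * j)) ∈ H
  cases : ∀ f ∈ edgesIn H Y, f ∈ edgesIn H (arc q 0 (2 * k)) ∨
    f ∈ edgesIn H (arc q (2 * k' + 1) (2 * M + 1)) ∨ f = s(x, q 0) ∨ f = s(x, q (2 * M)) ∨
    ∃ j, k < j ∧ j < k' ∧ f = s(x, q (2 * j))

theorem Radial.exists_fan {H : Finset (Sym2 Pt)} (hH : ∀ e ∈ H, ¬ e.IsDiag) {Y : Finset Pt}
    {x : Pt} {M : ℕ} {q : ℕ → Pt} (h : Radial Y x (2 * M + 1) q) (hM : 0 < M)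
    (hlight : ∀ Z ⊆ Y, Z.card < Y.card → ∀ m, Z.card = 2 * m →
      (m = 0 ∨ (edgesIn H Z).card < m) → Matchable H Z)
    (hcard : (edgesIn H Y).card ≤ M + 1) (hnm : ¬ Matchable H Y)
    (h0 : s(x, q 0) ∈ H) (h1 : s(x, q (2 * M)) ∈ H) : ∃ k k', Fan H Y x M q k k' := by
  classical
  have hY := h.card_eq
  have hK : ∀ k ≤ M, k ≤ (edgesIn H (arc q 0 (2 * k))).card ∨
      M - k ≤ (edgesIn H (arc q (2 * k + 1) (2 * M + 1))).card ∨ s(x, q (2 * k)) ∈ H := by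
    intro k hk
    by_contra! hcon
    refine hnm (h.matchable_of_pair (i := 2 * k) (by lia) hcon.2.2 ?_ ?_)
    · have hc := h.card_arc (i := 0) (j := 2 * k) (by lia)
      exact hlight _ (h.arc_subset (by lia)) (by lia) k hc (Or.inr hcon.1)
    · have hc := h.card_arc (i := 2 * k + 1) (j := 2 * M + 1) (by lia)
      exact hlight _ (h.arc_subset (by lia)) (by lia) (M - k) (by lia) (Or.inr hcon.2.1)
  have hex : ∃ k, k ≤ M ∧ M - k ≤ (edgesIn H (arc q (2 * k + 1) (2 * M + 1))).card :=
    ⟨M, le_rfl, by simp⟩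
  obtain ⟨k', ⟨hk'M, hk'⟩, hmin⟩ : ∃ k', (k' ≤ M ∧
      M - k' ≤ (edgesIn H (arc q (2 * k' + 1) (2 * M + 1))).card) ∧ ∀ j < k',
      ¬ (j ≤ M ∧ M - j ≤ (edgesIn H (arc q (2 * j + 1) (2 * M + 1))).card) :=
    ⟨Nat.find hex, Nat.find_spec hex, fun j hj => Nat.find_min hex hj⟩
  have memx : ∀ i, i < 2 * M + 1 → s(x, q i) ∈ H → s(x, q i) ∈ edgesIn H Y := by
    intro i hi hf
    rw [mem_edgesIn]
    refine ⟨hf, fun p hp => ?_⟩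
    rcases Sym2.mem_iff.mp hp with rfl | rfl
    · exact h.x_mem
    · exact h.mem hi
  have notx : ∀ i a b, b ≤ 2 * M + 1 → s(x, q i) ∉ edgesIn H (arc q a b) := by
    intro i a b hb hf
    rw [mem_edgesIn] at hf
    exact h.x_notMem_arc hb (hf.2 x (by simp))
  have hinj : ∀ i j, i < 2 * M + 1 → j < 2 * M + 1 → s(x, q i) = s(x, q j) → i = j := by
    intro i j hi hj hij
    exact h.inj hi hj (Sym2.congr_right.mp hij)
  have hstar : ∀ (I : Finset ℕ) (a b c d : ℕ), (∀ i ∈ I, i < 2 * M + 1 ∧ s(x, q i) ∈ H) →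
      b ≤ c + 1 → b ≤ 2 * M + 1 → d ≤ 2 * M + 1 →
      edgesIn H (arc q a b) ∪ edgesIn H (arc q c d) ∪ I.image (fun i => s(x, q i)) ⊆ edgesIn H Y ∧
      (edgesIn H (arc q a b) ∪ edgesIn H (arc q c d) ∪ I.image (fun i => s(x, q i))).card =
      (edgesIn H (arc q a b)).card + (edgesIn H (arc q c d)).card + I.card := by
    intro I a b c d hI hbc hb hd
    refine ⟨?_, ?_⟩
    · refine Finset.union_subset (Finset.union_subset (edgesIn_mono (h.arc_subset hb))
        (edgesIn_mono (h.arc_subset hd))) ?_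
      intro f hf
      obtain ⟨i, hi, rfl⟩ := Finset.mem_image.mp hf
      exact memx i (hI i hi).1 (hI i hi).2
    · rw [Finset.card_union_of_disjoint, Finset.card_union_of_disjoint
        (h.edgesIn_arc_disjoint hH hd hbc hb), Finset.card_image_of_injOn]
      · intro i hi j hj hij
        exact hinj i j (hI i hi).1 (hI j hj).1 hij
      · rw [Finset.disjoint_right]
        intro f hf hf'
        obtain ⟨i, hi, rfl⟩ := Finset.mem_image.mp hf
        rcases Finset.mem_union.mp hf' with hf' | hf'
        · exact notx _ _ _ hb hf'
        · exact notx _ _ _ hd hf'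
  have hk'pos : 0 < k' := by
    by_contra! hk0
    obtain rfl : k' = 0 := by lia
    obtain ⟨i1, i2⟩ := hstar {0, 2 * M} 0 0 1 (2 * M + 1) (by simp [h0, h1])
      (by lia) (by lia) le_rfl
    have := Finset.card_le_card i1
    rw [i2, Finset.card_pair (by lia)] at this
    simp only [mul_zero, zero_add] at hk'
    lia
  let P : ℕ → Prop := fun k => k ≤ (edgesIn H (arc q 0 (2 * k))).card
  have hkP : P (Nat.findGreatest P (k' - 1)) :=
    Nat.findGreatest_spec (m := 0) (Nat.zero_le _) (Nat.zero_le _)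
  have hkle := Nat.findGreatest_le (P := P) (k' - 1)
  have hkmax : ∀ j, Nat.findGreatest P (k' - 1) < j → j < k' → ¬ P j := fun j hj hj' =>
    Nat.findGreatest_is_greatest hj (by lia)
  generalize Nat.findGreatest P (k' - 1) = k at hkP hkle hkmax
  have hmid : ∀ j, k < j → j < k' → s(x, q (2 * j)) ∈ H := by
    intro j hj hj'
    rcases hK j (by lia) with h' | h' | h'
    · exact absurd h' (hkmax j hj hj')
    · exact absurd ⟨by lia, h'⟩ (hmin j hj')
    · exact h'
  let I : Finset ℕ := insert 0 (insert (2 * M) ((Finset.Ioo k k').image fun j => 2 * j))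
  have hIc : I.card = k' - k - 1 + 2 := by
    rw [Finset.card_insert_of_notMem, Finset.card_insert_of_notMem,
      Finset.card_image_of_injective, Nat.card_Ioo]
    · exact fun a b hab => by simpa using hab
    · simp only [Finset.mem_image, Finset.mem_Ioo, not_exists, not_and]
      lia
    · simp only [Finset.mem_image, Finset.mem_insert, Finset.mem_Ioo, not_exists, not_and, not_or]
      lia
  have hI : ∀ i ∈ I, i < 2 * M + 1 ∧ s(x, q i) ∈ H := by
    intro i hi
    simp only [I, Finset.mem_insert, Finset.mem_image, Finset.mem_Ioo] at hi
    rcases hi with rfl | rfl | ⟨j, hj, rfl⟩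
    · exact ⟨by lia, h0⟩
    · exact ⟨by lia, h1⟩
    · exact ⟨by lia, hmid j hj.1 hj.2⟩
  obtain ⟨hsub, hc⟩ := hstar I 0 (2 * k) (2 * k' + 1) (2 * M + 1) hI (by lia) (by lia) le_rfl
  have hle := Finset.card_le_card hsub
  have hkP' : k ≤ (edgesIn H (arc q 0 (2 * k))).card := hkP
  have heq := Finset.eq_of_subset_of_card_le hsub (by lia)
  refine ⟨k, k', h, by lia, hk'M, by lia, by lia, by lia, h0, h1, hmid, ?_⟩
  intro f hf
  rw [← heq] at hf
  simp only [I, Finset.mem_union, Finset.mem_image, Finset.mem_insert, Finset.mem_Ioo] at hf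
  rcases hf with (hf | hf) | ⟨i, rfl | rfl | ⟨j, hj, rfl⟩, rfl⟩
  · exact Or.inl hf
  · exact Or.inr (Or.inl hf)
  · simp
  · simp
  · exact Or.inr (Or.inr (Or.inr (Or.inr ⟨j, hj.1, hj.2, rfl⟩)))

/-- Some edge of `H` inside `Y` contains `x`. -/
def Touched (H : Finset (Sym2 Pt)) (Y : Finset Pt) (x : Pt) : Prop := ∃ f ∈ edgesIn H Y, x ∈ f

theorem Touched.card_lt {H : Finset (Sym2 Pt)} {Y Z : Finset Pt} {x : Pt} (h : Touched H Y x)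
    (hZY : Z ⊆ Y) (hx : x ∉ Z) : (edgesIn H Z).card < (edgesIn H Y).card := by
  obtain ⟨f, hf, hxf⟩ := h
  refine Finset.card_lt_card ⟨edgesIn_mono hZY, fun hsub => ?_⟩
  exact hx ((mem_edgesIn.mp (hsub hf)).2 x hxf)

theorem card_edgesIn_erase_of_not_touched {H : Finset (Sym2 Pt)} {Y : Finset Pt} {x : Pt}
    (h : ¬ Touched H Y x) : edgesIn H (Y.erase x) = edgesIn H Y := by
  refine Finset.Subset.antisymm (edgesIn_mono (Finset.erase_subset _ _)) fun f hf => ?_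
  have hf' := mem_edgesIn.mp hf
  refine mem_edgesIn.mpr ⟨hf'.1, fun p hp => Finset.mem_erase.mpr ⟨?_, hf'.2 p hp⟩⟩
  rintro rfl
  exact h ⟨f, hf, hp⟩

/-- Fewer than `m` forbidden edges on `2 * m` points leave a matching. -/
theorem matchable_of_card_lt {H : Finset (Sym2 Pt)} (hH : ∀ e ∈ H, ¬ e.IsDiag) (m : ℕ) :
    ∀ Y : Finset Pt, GenPos Y → Y.card = 2 * m → (m = 0 ∨ (edgesIn H Y).card < m) →
    Matchable H Y := by
  induction m using Nat.strong_induction_on with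
  | _ m ih =>
  intro Y hgp hY hm
  rcases Nat.eq_zero_or_pos m with rfl | hmpos
  · obtain rfl : Y = ∅ := by simpa using hY
    exact matchable_empty H
  have he : (edgesIn H Y).card < m := by lia
  obtain ⟨M, rfl⟩ : ∃ M, m = M + 1 := ⟨m - 1, by lia⟩
  obtain ⟨p, hp⟩ := exists_isExt (Y := Y) (Finset.card_pos.mp (by lia))
  obtain ⟨q, hq⟩ := hp.exists_radial hgp (N := 2 * M + 1) (by lia)
  have hpair : ∀ a b, HullEdge Y a b → s(a, b) ∉ H → (Touched H Y a ∨ Touched H Y b ∨ M = 0) →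
      Matchable H Y := by
    intro a b hab hn ht
    have hsub : (Y.erase a).erase b ⊆ Y := (Finset.erase_subset _ _).trans (Finset.erase_subset _ _)
    refine hab.matchable hn (ih M (by lia) _ (hgp.mono hsub) ?_ ?_)
    · rw [Finset.card_erase_of_mem (Finset.mem_erase.mpr ⟨hab.2.2.1.symm, hab.2.1⟩),
        Finset.card_erase_of_mem hab.1]
      lia
    · rcases ht with ht | ht | ht
      · have := ht.card_lt hsub (by simp)
        lia
      · have := ht.card_lt hsub (by simp)
        lia
      · exact Or.inl ht
  have hlight : ∀ Z ⊆ Y, Z.card < Y.card → ∀ m, Z.card = 2 * m →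
      (m = 0 ∨ (edgesIn H Z).card < m) → Matchable H Z :=
    fun Z hZ hc m hm hm' => ih m (by lia) Z (hgp.mono hZ) hm hm'
  have hH0 := hq.hullEdge_zero (by lia)
  have hH1 := hq.hullEdge_last
  by_cases hM : M = 0
  · subst hM
    refine hpair _ _ hH0 (fun hmem => ?_) (by simp)
    have : s(p, q 0) ∈ edgesIn H Y := mem_edgesIn.mpr ⟨hmem, fun z hz => by
      rcases Sym2.mem_iff.mp hz with rfl | rfl
      · exact hp.1
      · exact hH0.2.1⟩
    have := Finset.card_pos.mpr ⟨_, this⟩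
    lia
  by_cases hpt : Touched H Y p
  · by_cases h0 : s(p, q 0) ∈ H
    · by_cases h1 : s(p, q (2 * M)) ∈ H
      · by_contra hnm
        obtain ⟨k, k', hfan⟩ := hq.exists_fan hH (by lia) hlight (by lia) hnm h0 h1
        have := hfan.card
        lia
      · exact hpair _ _ hH1 (by rwa [Sym2.eq_swap]) (by tauto)
    · exact hpair _ _ hH0 h0 (by tauto)
  by_contra hnm
  have hpn : ∀ i < 2 * M + 1, s(p, q i) ∉ H := by
    intro i hi hmem
    refine hpt ⟨_, mem_edgesIn.mpr ⟨hmem, fun z hz => ?_⟩, Sym2.mem_mk_left _ _⟩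
    rcases Sym2.mem_iff.mp hz with rfl | rfl
    · exact hp.1
    · exact hq.mem hi
  have hK : ∀ k ≤ M, (1 ≤ k ∧ k ≤ (edgesIn H (arc q 0 (2 * k))).card) ∨
      (k < M ∧ M - k ≤ (edgesIn H (arc q (2 * k + 1) (2 * M + 1))).card) := by
    intro k hk
    by_contra! hcon
    refine hnm (hq.matchable_of_pair (i := 2 * k) (by lia) (hpn _ (by lia)) ?_ ?_)
    · have hc := hq.card_arc (i := 0) (j := 2 * k) (by lia)
      exact hlight _ (hq.arc_subset (by lia)) (by lia) k hc (by lia)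
    · have hc := hq.card_arc (i := 2 * k + 1) (j := 2 * M + 1) (by lia)
      exact hlight _ (hq.arc_subset (by lia)) (by lia) (M - k) (by lia) (by lia)
  have hex : ∃ k, 1 ≤ k ∧ k ≤ (edgesIn H (arc q 0 (2 * k))).card := by
    refine ⟨M, ?_⟩
    rcases hK M le_rfl with h | h
    · exact h
    · lia
  obtain ⟨k', ⟨hk'1, hk'⟩, hmin⟩ : ∃ k', (1 ≤ k' ∧ k' ≤ (edgesIn H (arc q 0 (2 * k'))).card) ∧
      ∀ j < k', ¬ (1 ≤ j ∧ j ≤ (edgesIn H (arc q 0 (2 * j))).card) :=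
    ⟨Nat.find hex, Nat.find_spec hex, fun j hj => Nat.find_min hex hj⟩
  have hk'M : k' ≤ M := by
    by_contra! hlt
    rcases hK M le_rfl with h | h
    · exact hmin M hlt h
    · lia
  obtain ⟨k, rfl⟩ : ∃ k, k' = k + 1 := ⟨k' - 1, by lia⟩
  have hR : M - k ≤ (edgesIn H (arc q (2 * k + 1) (2 * M + 1))).card := by
    rcases hK k (by lia) with h | h
    · exact absurd h (hmin k (by lia))
    · exact h.2
  have hsum := card_edgesIn_add_le
    (edgesIn_mono (hq.arc_subset (i := 0) (j := 2 * (k + 1)) (by lia)))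
    (edgesIn_mono (hq.arc_subset le_rfl))
    (hq.edgesIn_arc_disjoint hH (i := 0) (j := 2 * (k + 1)) (i' := 2 * k + 1) le_rfl
      (by lia) (by lia))
  lia

/-- `2 * m` points in general position on which `H` has exactly `m` edges and blocks every
non-crossing perfect matching. -/
structure Blocker (H : Finset (Sym2 Pt)) (Y : Finset Pt) (m : ℕ) : Prop where
  diag : ∀ e ∈ H, ¬ e.IsDiag
  gp : GenPos Y
  card : Y.card = 2 * m
  edges : (edgesIn H Y).card = m
  notMatchable : ¬ Matchable H Y

theorem Radial.exists_hullEdge {Y : Finset Pt} {x : Pt} {N : ℕ} {q : ℕ → Pt}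
    (h : Radial Y x N q) (hgp : GenPos Y) {i : ℕ} (h0 : 0 < i) (hi : i < N) :
    ∃ a ∈ arc q 0 i, ∃ b ∈ arc q i N, HullEdge Y a b := by
  classical
  obtain ⟨k, hk, hmax⟩ := ((Finset.range i).filter fun k => IsExt Y (q k)).exists_max_image id
    ⟨0, by simpa using ⟨h0, (h.hullEdge_zero (by lia)).isExt_right⟩⟩
  rw [Finset.mem_filter, Finset.mem_range] at hk
  obtain ⟨r, hr⟩ := hk.2.exists_radial hgp h.card_eq
  have hab := hr.hullEdge_zero (by lia)
  refine ⟨q k, mem_arc.mpr ⟨k, by lia, hk.1, rfl⟩, r 0, ?_, hab⟩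
  obtain hbx | ⟨j, hj, hjb⟩ := (h.mem_iff (r 0)).mp hab.2.1
  · have h1 := hab.2.2.2 (q i) (h.mem hi) (fun he => by have := h.inj hi (by lia) he; lia)
      (by rw [hbx]; exact h.ne i hi)
    rw [hbx, cross_swap] at h1
    have h2 := h.pos k i hk.1 hi
    linarith
  · rw [← hjb] at hab ⊢
    have h1 := hab.2.2.2 x h.x_mem (h.ne k (by lia)).symm (h.ne j hj).symm
    rw [cross_rotate] at h1
    have h2 := h.lt_of_cross_pos (by lia) h1
    refine mem_arc.mpr ⟨j, ?_, hj, rfl⟩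
    by_contra! hlt
    have := hmax j (by simpa using ⟨hlt, hab.isExt_right⟩)
    simp only [id] at this
    lia

namespace Blocker

variable {H : Finset (Sym2 Pt)} {Y : Finset Pt} {m : ℕ}

theorem pos (h : Blocker H Y m) : 0 < m := by
  by_contra! hm
  obtain rfl : m = 0 := by lia
  obtain rfl : Y = ∅ := by simpa using h.card
  exact h.notMatchable (matchable_empty H)

theorem light (h : Blocker H Y m) : ∀ Z ⊆ Y, ∀ k, Z.card = 2 * k →
    (k = 0 ∨ (edgesIn H Z).card < k) → Matchable H Z :=
  fun Z hZ k hk hk' => matchable_of_card_lt h.diag k Z (h.gp.mono hZ) hk hk'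

theorem of_subset (h : Blocker H Y m) {Z : Finset Pt} (hZ : Z ⊆ Y) {k : ℕ} (hk : Z.card = 2 * k)
    (he : (edgesIn H Z).card ≤ k) (hn : ¬ Matchable H Z) : Blocker H Z k := by
  refine ⟨h.diag, h.gp.mono hZ, hk, he.antisymm ?_, hn⟩
  by_contra! hlt
  exact hn (h.light Z hZ k hk (Or.inr hlt))

/-- At most one edge of `H` meets a hull edge that is not in `H`. -/
theorem eq_of_hullEdge (h : Blocker H Y m) {a b : Pt} (hab : HullEdge Y a b) (hn : s(a, b) ∉ H)
    {f g : Sym2 Pt} (hf : f ∈ edgesIn H Y) (hg : g ∈ edgesIn H Y) (haf : a ∈ f ∨ b ∈ f)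
    (hag : a ∈ g ∨ b ∈ g) : f = g := by
  by_contra hfg
  have hsub : (Y.erase a).erase b ⊆ Y := (Finset.erase_subset _ _).trans (Finset.erase_subset _ _)
  have hc : ((Y.erase a).erase b).card = 2 * (m - 1) := by
    rw [Finset.card_erase_of_mem (Finset.mem_erase.mpr ⟨hab.2.2.1.symm, hab.2.1⟩),
      Finset.card_erase_of_mem hab.1, h.card]
    lia
  have he : edgesIn H ((Y.erase a).erase b) ⊆ ((edgesIn H Y).erase f).erase g := by
    intro e he
    have hno : ∀ e', (a ∈ e' ∨ b ∈ e') → e ≠ e' := by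
      rintro e' h' rfl
      rcases h' with h' | h'
      · simpa using (mem_edgesIn.mp he).2 a h'
      · simpa using (mem_edgesIn.mp he).2 b h'
    exact Finset.mem_erase.mpr ⟨hno g hag, Finset.mem_erase.mpr ⟨hno f haf, edgesIn_mono hsub he⟩⟩
  have hle := Finset.card_le_card he
  rw [Finset.card_erase_of_mem (Finset.mem_erase.mpr ⟨Ne.symm hfg, hg⟩),
    Finset.card_erase_of_mem hf, h.edges] at hle
  have h2 : 2 ≤ m := by
    rw [← h.edges, ← Finset.card_pair hfg]
    exact Finset.card_le_card (by simp [Finset.insert_subset_iff, hf, hg])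
  exact h.notMatchable (hab.matchable hn (h.light _ hsub _ hc (by lia)))

theorem not_touched_of_hullEdge (h : Blocker H Y m) {a b : Pt} (hab : HullEdge Y a b)
    (hn : s(a, b) ∉ H) (ha : Touched H Y a) : ¬ Touched H Y b := by
  rintro ⟨g, hg, hbg⟩
  obtain ⟨f, hf, haf⟩ := ha
  obtain rfl := h.eq_of_hullEdge hab hn hf hg (Or.inl haf) (Or.inr hbg)
  rw [(Sym2.mem_and_mem_iff hab.2.2.1).mp ⟨haf, hbg⟩] at hf
  exact hn (mem_edgesIn.mp hf).1

theorem exists_fan (h : Blocker H Y m) {x : Pt} {M : ℕ} {q : ℕ → Pt}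
    (hq : Radial Y x (2 * M + 1) q) (hM : 0 < M) (h0 : s(x, q 0) ∈ H)
    (h1 : s(x, q (2 * M)) ∈ H) : ∃ k k', Fan H Y x M q k k' := by
  have h2 := hq.card_eq
  have h3 := h.card
  have h4 := h.edges
  exact hq.exists_fan h.diag hM (fun Z hZ _ m hm hm' => h.light Z hZ m hm hm') (by lia)
    h.notMatchable h0 h1

theorem exists_not_touched (h : Blocker H Y m) (hm : 2 ≤ m) :
    ∃ p, IsExt Y p ∧ ¬ Touched H Y p := by
  obtain ⟨M, rfl⟩ : ∃ M, m = M + 1 := ⟨m - 1, by lia⟩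
  have hY := h.card
  obtain ⟨p, hp⟩ := exists_isExt (Y := Y) (Finset.card_pos.mp (by lia))
  obtain ⟨q, hq⟩ := hp.exists_radial h.gp (N := 2 * M + 1) (by lia)
  by_cases hpt : Touched H Y p
  swap
  · exact ⟨p, hp, hpt⟩
  have hH0 := hq.hullEdge_zero (by lia)
  have hH1 := hq.hullEdge_last
  by_cases h0 : s(p, q 0) ∈ H
  swap
  · exact ⟨_, hH0.isExt_right, h.not_touched_of_hullEdge hH0 h0 hpt⟩
  by_cases h1 : s(p, q (2 * M)) ∈ H
  swap
  · refine ⟨_, hH1.isExt_left, fun ht => ?_⟩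
    exact h.not_touched_of_hullEdge hH1 (by rwa [Sym2.eq_swap]) ht hpt
  obtain ⟨k, k', hfan⟩ := h.exists_fan hq (by lia) h0 h1
  have hlt := hfan.lt
  have hle := hfan.le
  obtain ⟨a, ha, b, hb, hab⟩ := hq.exists_hullEdge h.gp (i := 2 * k + 1) (by lia) (by lia)
  obtain ⟨i, -, hi, rfl⟩ := mem_arc.mp ha
  obtain ⟨j, hj, hj', rfl⟩ := mem_arc.mp hb
  have hn : s(q i, q j) ∉ H := by
    intro hmem
    have hx : p ∉ s(q i, q j) := by
      intro hx
      rcases Sym2.mem_iff.mp hx with hx | hx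
      · exact hq.ne i (by lia) hx.symm
      · exact hq.ne j (by lia) hx.symm
    have hm : s(q i, q j) ∈ edgesIn H Y := mem_edgesIn.mpr ⟨hmem, fun z hz => by
      rcases Sym2.mem_iff.mp hz with rfl | rfl
      · exact hab.1
      · exact hab.2.1⟩
    rcases hfan.cases _ hm with h' | h' | h' | h' | ⟨j, -, -, h'⟩
    · have := (hq.mem_arc_iff (by lia) (by lia)).mp ((mem_edgesIn.mp h').2 (q j) (by simp))
      lia
    · have := (hq.mem_arc_iff (by lia) (by lia)).mp ((mem_edgesIn.mp h').2 (q i) (by simp))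
      lia
    all_goals exact hx (h' ▸ Sym2.mem_mk_left _ _)
  by_cases hat : Touched H Y (q i)
  · exact ⟨_, hab.isExt_right, h.not_touched_of_hullEdge hab hn hat⟩
  · exact ⟨_, hab.isExt_left, hat⟩

/-- A set of points that is a union of connected components of `H` on `Y` (up to isolated points)
contains all non-isolated points or none, and there are more non-isolated points than edges. -/
theorem connected_and_card (h : Blocker H Y m) :
    (∀ S : Set Pt, (∀ f ∈ edgesIn H Y, (∀ p ∈ f, p ∈ S) ∨ ∀ p ∈ f, p ∉ S) →
      (∀ f ∈ edgesIn H Y, ∀ p ∈ f, p ∈ S) ∨ ∀ f ∈ edgesIn H Y, ∀ p ∈ f, p ∉ S) ∧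
    ∃ V : Finset Pt, (∀ v ∈ V, v ∈ Y ∧ Touched H Y v) ∧ m + 1 ≤ V.card := by
  induction m using Nat.strong_induction_on generalizing Y with
  | _ m ih =>
  have hY := h.card
  have hE := h.edges
  have hpos := h.pos
  obtain ⟨M, rfl⟩ : ∃ M, m = M + 1 := ⟨m - 1, by lia⟩
  by_cases hM : M = 0
  · subst hM
    obtain ⟨f, hf⟩ := Finset.card_eq_one.mp hE
    refine ⟨fun S hS => ?_, ?_⟩
    · simp only [hf, Finset.mem_singleton, forall_eq] at hS ⊢
      exact hS
    · induction f with | _ a b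
      have hm : s(a, b) ∈ edgesIn H Y := by simp [hf]
      have hab : a ≠ b := fun he => h.diag _ (mem_edgesIn.mp hm).1 (by simp [he])
      refine ⟨{a, b}, ?_, by rw [Finset.card_pair hab]⟩
      intro v hv
      have hv' : v ∈ s(a, b) := by simpa using hv
      exact ⟨(mem_edgesIn.mp hm).2 v hv', _, hm, hv'⟩
  obtain ⟨p, hp, hpt⟩ := h.exists_not_touched (by lia)
  obtain ⟨q, hq⟩ := hp.exists_radial h.gp (N := 2 * M + 1) (by lia)
  have hins : ∀ i j, j ≤ 2 * M + 1 → edgesIn H (insert p (arc q i j)) = edgesIn H (arc q i j) ∧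
      (insert p (arc q i j)).card = j - i + 1 ∧ insert p (arc q i j) ⊆ Y := by
    intro i j hj
    have hsub : insert p (arc q i j) ⊆ Y :=
      Finset.insert_subset hp.1 (hq.arc_subset hj)
    refine ⟨?_, ?_, hsub⟩
    · have : ¬ Touched H (insert p (arc q i j)) p := fun ⟨f, hf, hpf⟩ =>
        hpt ⟨f, edgesIn_mono hsub hf, hpf⟩
      rw [← card_edgesIn_erase_of_not_touched this,
        Finset.erase_insert (hq.x_notMem_arc hj)]
    · rw [Finset.card_insert_of_notMem (hq.x_notMem_arc hj), hq.card_arc hj]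
  have hex : ∃ k, k + 1 ≤ (edgesIn H (arc q 0 (2 * k + 1))).card := by
    refine ⟨M, ?_⟩
    obtain ⟨h1, h2, h3⟩ := hins 0 (2 * M + 1) le_rfl
    rw [← h1, Finset.eq_of_subset_of_card_le h3 (by lia), hE]
  obtain ⟨k', hk', hmin⟩ : ∃ k', k' + 1 ≤ (edgesIn H (arc q 0 (2 * k' + 1))).card ∧
      ∀ j < k', ¬ (j + 1 ≤ (edgesIn H (arc q 0 (2 * j + 1))).card) :=
    ⟨Nat.find hex, Nat.find_spec hex, fun j hj => Nat.find_min hex hj⟩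
  have hk'0 : k' ≠ 0 := by
    rintro rfl
    have := hq.edgesIn_arc_disjoint h.diag (i := 0) (j := 1) (i' := 0) (j' := 1)
      (by lia) le_rfl (by lia)
    rw [Finset.disjoint_self_iff_empty] at this
    simp [this] at hk'
  obtain ⟨k, rfl⟩ : ∃ k, k' = k + 1 := ⟨k' - 1, by lia⟩
  have hkM : k + 1 ≤ M := by
    by_contra! hlt
    obtain ⟨h1, h2, h3⟩ := hins 0 (2 * M + 1) le_rfl
    have := hmin M hlt
    rw [← h1, Finset.eq_of_subset_of_card_le h3 (by lia), hE] at this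
    exact this le_rfl
  have hkk := hmin k (by lia)
  have hkeq : 2 * (k + 1) + 1 = 2 * k + 3 := by lia
  rw [hkeq] at hk'
  have hRn : ¬ Matchable H (arc q (2 * k + 1) (2 * M + 1)) := by
    intro hmat
    obtain ⟨h1, h2, h3⟩ := hins 0 (2 * k + 1) (by lia)
    refine h.notMatchable (hq.matchable_of_insert_arc (i := 2 * k + 1) (by lia) ?_ hmat)
    exact h.light _ h3 (k + 1) (by lia) (by rw [h1]; lia)
  have hRc := hq.card_arc (i := 2 * k + 1) (j := 2 * M + 1) le_rfl
  have hRsub := hq.arc_subset (i := 2 * k + 1) (j := 2 * M + 1) le_rfl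
  have hRe : M - k ≤ (edgesIn H (arc q (2 * k + 1) (2 * M + 1))).card := by
    by_contra! hlt
    exact hRn (h.light _ hRsub (M - k) (by lia) (by lia))
  have hAsub := hq.arc_subset (i := 0) (j := 2 * k + 3) (by lia)
  have hz1 : q (2 * k + 1) ≠ q (2 * k + 2) := fun he => by
    have := hq.inj (by lia) (by lia) he
    lia
  have hinter : edgesIn H (arc q 0 (2 * k + 3)) ∩ edgesIn H (arc q (2 * k + 1) (2 * M + 1)) ⊆
      {s(q (2 * k + 1), q (2 * k + 2))} := by
    intro f hf
    rw [Finset.mem_inter, mem_edgesIn, mem_edgesIn] at hf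
    have hpt : ∀ w ∈ f, w = q (2 * k + 1) ∨ w = q (2 * k + 2) := by
      intro w hw
      obtain ⟨i, -, hi, rfl⟩ := mem_arc.mp (hf.1.2 w hw)
      have := (hq.mem_arc_iff (by lia) le_rfl).mp (hf.2.2 _ hw)
      obtain rfl | rfl : i = 2 * k + 1 ∨ i = 2 * k + 2 := by lia
      · simp
      · simp
    have hd := h.diag f hf.1.1
    induction f with | _ a b
    have hab : a ≠ b := by simpa using hd
    rw [Finset.mem_singleton]
    rcases hpt a (by simp) with rfl | rfl <;> rcases hpt b (by simp) with rfl | rfl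
    · exact absurd rfl hab
    · rfl
    · exact Sym2.eq_swap
    · exact absurd rfl hab
  have hun : edgesIn H (arc q 0 (2 * k + 3)) ∪ edgesIn H (arc q (2 * k + 1) (2 * M + 1)) ⊆
      edgesIn H Y := Finset.union_subset (edgesIn_mono hAsub) (edgesIn_mono hRsub)
  have hsum := Finset.card_union_add_card_inter (edgesIn H (arc q 0 (2 * k + 3)))
    (edgesIn H (arc q (2 * k + 1) (2 * M + 1)))
  have hunc := Finset.card_le_card hun
  have hintc := Finset.card_le_card hinter
  rw [Finset.card_singleton] at hintc
  have huneq := Finset.eq_of_subset_of_card_le hun (by lia)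
  have hinteq := Finset.eq_of_subset_of_card_le hinter (by rw [Finset.card_singleton]; lia)
  have he0 : s(q (2 * k + 1), q (2 * k + 2)) ∈ edgesIn H (arc q 0 (2 * k + 3)) ∩
      edgesIn H (arc q (2 * k + 1) (2 * M + 1)) := by rw [hinteq]; simp
  rw [Finset.mem_inter] at he0
  have hright : Blocker H (arc q (2 * k + 1) (2 * M + 1)) (M - k) :=
    h.of_subset hRsub (by lia) (by lia) hRn
  have hLsub := hq.arc_subset (i := 0) (j := 2 * k + 2) (by lia)
  have hLA : edgesIn H (arc q 0 (2 * k + 2)) ⊆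
      (edgesIn H (arc q 0 (2 * k + 3))).erase s(q (2 * k + 1), q (2 * k + 2)) := by
    intro f hf
    refine Finset.mem_erase.mpr ⟨?_, edgesIn_mono (arc_mono le_rfl (by lia)) hf⟩
    rintro rfl
    have := (mem_edgesIn.mp hf).2 (q (2 * k + 2)) (by simp)
    rw [hq.mem_arc_iff (by lia) (by lia)] at this
    lia
  have hLAc := Finset.card_le_card hLA
  rw [Finset.card_erase_of_mem he0.1] at hLAc
  have hleft : Blocker H (arc q 0 (2 * k + 2)) (k + 1) := by
    have hc := hq.card_arc (i := 0) (j := 2 * k + 2) (by lia)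
    refine h.of_subset hLsub (by lia) (by lia) fun hmat => ?_
    refine h.notMatchable (hq.matchable_of_arc_insert (i := 2 * k + 2) (by lia) hmat ?_)
    obtain ⟨h1, h2, h3⟩ := hins (2 * k + 2) (2 * M + 1) le_rfl
    refine h.light _ h3 (M - k) (by lia) (Or.inr ?_)
    rw [h1]
    have ht : Touched H (arc q (2 * k + 1) (2 * M + 1)) (q (2 * k + 1)) := ⟨_, he0.2, by simp⟩
    have := ht.card_lt (Z := arc q (2 * k + 2) (2 * M + 1)) (arc_mono (by lia) le_rfl) (by
      rw [hq.mem_arc_iff (by lia) (by lia)]; lia)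
    lia
  have hall : ∀ f ∈ edgesIn H Y, f ∈ edgesIn H (arc q 0 (2 * k + 2)) ∨
      f ∈ edgesIn H (arc q (2 * k + 1) (2 * M + 1)) := by
    intro f hf
    rw [← huneq, Finset.mem_union] at hf
    rcases hf with hf | hf
    · by_cases hfe : f = s(q (2 * k + 1), q (2 * k + 2))
      · exact Or.inr (hfe ▸ he0.2)
      · left
        have := hleft.edges
        rw [Finset.eq_of_subset_of_card_le hLA (by rw [Finset.card_erase_of_mem he0.1]; lia)]
        exact Finset.mem_erase.mpr ⟨hfe, hf⟩
    · exact Or.inr hf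
  have htl : Touched H (arc q 0 (2 * k + 2)) (q (2 * k + 1)) := by
    by_contra hnt
    have hle : edgesIn H (arc q 0 (2 * k + 2)) ⊆ edgesIn H (arc q 0 (2 * k + 1)) := by
      intro f hf
      refine mem_edgesIn.mpr ⟨(mem_edgesIn.mp hf).1, fun w hw => ?_⟩
      obtain ⟨i, hi, hi', rfl⟩ := mem_arc.mp ((mem_edgesIn.mp hf).2 w hw)
      refine mem_arc.mpr ⟨i, hi, ?_, rfl⟩
      have : i ≠ 2 * k + 1 := by
        rintro rfl
        exact hnt ⟨f, hf, hw⟩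
      lia
    have := Finset.card_le_card hle
    have := hleft.edges
    lia
  obtain ⟨hlc, VL, hVL, hVLc⟩ := ih _ (by lia) hleft
  obtain ⟨hrc, VR, hVR, hVRc⟩ := ih _ (by lia) hright
  refine ⟨fun S hS => ?_, VL ∪ VR, ?_, ?_⟩
  · have hl := hlc S fun f hf => hS f (edgesIn_mono hLsub hf)
    have hr := hrc S fun f hf => hS f (edgesIn_mono hRsub hf)
    obtain ⟨g, hg, hzg⟩ := htl
    by_cases hz : q (2 * k + 1) ∈ S
    · have hl' := hl.resolve_right fun hcon => hcon g hg _ hzg hz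
      have hr' := hr.resolve_right fun hcon => hcon _ he0.2 (q (2 * k + 1)) (by simp) hz
      refine Or.inl fun f hf => ?_
      rcases hall f hf with hf | hf
      · exact hl' f hf
      · exact hr' f hf
    · have hl' := hl.resolve_left fun hcon => hz (hcon g hg _ hzg)
      have hr' := hr.resolve_left fun hcon => hz (hcon _ he0.2 (q (2 * k + 1)) (by simp))
      refine Or.inr fun f hf => ?_
      rcases hall f hf with hf | hf
      · exact hl' f hf
      · exact hr' f hf
  · intro v hv
    rcases Finset.mem_union.mp hv with hv | hv
    · obtain ⟨h1, g, hg, hvg⟩ := hVL v hv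
      exact ⟨hLsub h1, g, edgesIn_mono hLsub hg, hvg⟩
    · obtain ⟨h1, g, hg, hvg⟩ := hVR v hv
      exact ⟨hRsub h1, g, edgesIn_mono hRsub hg, hvg⟩
  · have hi : VL ∩ VR ⊆ {q (2 * k + 1)} := by
      intro v hv
      rw [Finset.mem_inter] at hv
      obtain ⟨i, -, hi, rfl⟩ := mem_arc.mp (hVL v hv.1).1
      have := (hq.mem_arc_iff (by lia) le_rfl).mp (hVR _ hv.2).1
      obtain rfl : i = 2 * k + 1 := by lia
      simp
    have h1 := Finset.card_le_card hi
    rw [Finset.card_singleton] at h1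
    have h2 := Finset.card_union_add_card_inter VL VR
    lia

end Blocker

/-- Some two distinct edges of `H` inside `Y` contain `x`. -/
def Branching (H : Finset (Sym2 Pt)) (Y : Finset Pt) (x : Pt) : Prop :=
  ∃ f ∈ edgesIn H Y, ∃ g ∈ edgesIn H Y, f ≠ g ∧ x ∈ f ∧ x ∈ g

open Classical in
/-- The points of `Y` to the right of the line from `x` to `y`. -/
def rightSide (Y : Finset Pt) (x y : Pt) : Finset Pt := Y.filter fun w => cross x y w < 0

theorem mem_rightSide {Y : Finset Pt} {x y w : Pt} :
    w ∈ rightSide Y x y ↔ w ∈ Y ∧ cross x y w < 0 :=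
  Finset.mem_filter

theorem mk_mem_edgesIn {H : Finset (Sym2 Pt)} {Y : Finset Pt} {a b : Pt} :
    s(a, b) ∈ edgesIn H Y ↔ s(a, b) ∈ H ∧ a ∈ Y ∧ b ∈ Y := by
  simp [mem_edgesIn]

theorem Radial.rightSide_eq {Y : Finset Pt} {x : Pt} {N : ℕ} {q : ℕ → Pt} (h : Radial Y x N q)
    {i : ℕ} (hi : i < N) : rightSide Y x (q i) = arc q 0 i := by
  ext w
  rw [mem_rightSide, mem_arc]
  constructor
  · rintro ⟨hw, hc⟩
    obtain rfl | ⟨j, hj, rfl⟩ := (h.mem_iff w).mp hw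
    · rw [cross_self_left] at hc
      exact hc.false.elim
    · rw [← neg_pos, ← cross_swap_right] at hc
      exact ⟨j, by lia, h.lt_of_cross_pos hj hc, rfl⟩
  · rintro ⟨j, -, hj, rfl⟩
    exact ⟨h.mem (hj.trans hi), h.neg hj hi⟩

theorem IsExt.cross_trans {Y : Finset Pt} {x a b c : Pt} (h : IsExt Y x) (hgp : GenPos Y)
    (ha : a ∈ Y) (hb : b ∈ Y) (hc : c ∈ Y) (hab : 0 < cross x a b) (hbc : 0 < cross x b c) :
    0 < cross x a c := by
  have hpos : 0 < Y.card := Finset.card_pos.mpr ⟨a, ha⟩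
  obtain ⟨q, hq⟩ := h.exists_radial hgp (N := Y.card - 1) (by lia)
  obtain rfl | ⟨i, hi, rfl⟩ := (hq.mem_iff a).mp ha
  · simp [cross] at hab
  obtain rfl | ⟨j, hj, rfl⟩ := (hq.mem_iff b).mp hb
  · simp [cross] at hbc
  obtain rfl | ⟨k, hk, rfl⟩ := (hq.mem_iff c).mp hc
  · rw [cross_self_left] at hbc
    exact hbc.false.elim
  · exact hq.pos i k ((hq.lt_of_cross_pos hi hab).trans (hq.lt_of_cross_pos hj hbc)) hk

theorem HullEdge.right_unique {Y : Finset Pt} {a b b' : Pt} (h : HullEdge Y a b)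
    (h' : HullEdge Y a b') : b = b' := by
  by_contra hne
  have h1 := h.2.2.2 b' h'.2.1 h'.2.2.1.symm (Ne.symm hne)
  have h2 := h'.2.2.2 b h.2.1 h.2.2.1.symm hne
  rw [cross_swap_right] at h2
  linarith

theorem HullEdge.left_unique {Y : Finset Pt} {a a' b : Pt} (h : HullEdge Y a b)
    (h' : HullEdge Y a' b) : a = a' := by
  by_contra hne
  have h1 := h.2.2.2 a' h'.1 (Ne.symm hne) h'.2.2.1
  have h2 := h'.2.2.2 a h.1 hne h.2.2.1
  rw [← cross_rotate, cross_swap_right, cross_rotate] at h2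
  rw [← cross_rotate] at h1
  rw [← cross_rotate] at h2
  linarith

theorem StrictSep.mono {Y Z Y' Z' : Finset Pt} (h : StrictSep Y Z) (hY : Y' ⊆ Y) (hZ : Z' ⊆ Z) :
    StrictSep Y' Z' := by
  obtain ⟨c, d, h1, h2⟩ := h
  exact ⟨c, d, fun w hw => h1 w (hY hw), fun w hw => h2 w (hZ hw)⟩

theorem Blocker.exists_fan_of_branching {H : Finset (Sym2 Pt)} {Y : Finset Pt} {x : Pt} {m : ℕ}
    (h : Blocker H Y m) (hx : IsExt Y x) (hb : Branching H Y x) :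
    ∃ M q k k', m = M + 1 ∧ 0 < M ∧ Fan H Y x M q k k' := by
  obtain ⟨f, hf, g, hg, hfg, hxf, hxg⟩ := hb
  have h2 : 2 ≤ m := by
    rw [← h.edges, ← Finset.card_pair hfg]
    exact Finset.card_le_card (by simp [Finset.insert_subset_iff, hf, hg])
  have hY := h.card
  obtain ⟨M, rfl⟩ : ∃ M, m = M + 1 := ⟨m - 1, by lia⟩
  obtain ⟨q, hq⟩ := hx.exists_radial h.gp (N := 2 * M + 1) (by lia)
  have h0 : s(x, q 0) ∈ H := by
    by_contra hn
    exact hfg (h.eq_of_hullEdge (hq.hullEdge_zero (by lia)) hn hf hg (Or.inl hxf) (Or.inl hxg))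
  have h1 : s(x, q (2 * M)) ∈ H := by
    by_contra hn
    exact hfg (h.eq_of_hullEdge hq.hullEdge_last (by rwa [Sym2.eq_swap]) hf hg (Or.inr hxf)
      (Or.inr hxg))
  obtain ⟨k, k', hfan⟩ := h.exists_fan hq (by lia) h0 h1
  exact ⟨M, q, k, k', rfl, by lia, hfan⟩

namespace Fan

variable {H : Finset (Sym2 Pt)} {Y : Finset Pt} {x : Pt} {M k k' : ℕ} {q : ℕ → Pt}

theorem cases_of_notMem (h : Fan H Y x M q k k') {f : Sym2 Pt} (hf : f ∈ edgesIn H Y)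
    (hx : x ∉ f) : f ∈ edgesIn H (arc q 0 (2 * k)) ∨
      f ∈ edgesIn H (arc q (2 * k' + 1) (2 * M + 1)) := by
  rcases h.cases f hf with h' | h' | h' | h' | ⟨j, -, -, h'⟩
  · exact Or.inl h'
  · exact Or.inr h'
  all_goals exact absurd (h' ▸ Sym2.mem_mk_left _ _) hx

theorem card_arc_right_le (h : Fan H Y x M q k k') {i : ℕ} (hi : 2 * k ≤ i) :
    (edgesIn H (arc q i (2 * M + 1))).card ≤ M - k' := by
  rw [← h.card_right]
  refine Finset.card_le_card fun f hf => ?_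
  have hsub := h.radial.arc_subset (i := i) le_rfl
  have hx : x ∉ f := fun hx => h.radial.x_notMem_arc le_rfl ((mem_edgesIn.mp hf).2 x hx)
  refine (h.cases_of_notMem (edgesIn_mono hsub hf) hx).resolve_left fun hl => ?_
  have h1 := (mem_edgesIn.mp hl).2 _ (Sym2.out_fst_mem f)
  have h2 := (mem_edgesIn.mp hf).2 _ (Sym2.out_fst_mem f)
  have hlt := h.lt
  have hle := h.le
  obtain ⟨j, -, hj, hje⟩ := mem_arc.mp h1
  rw [← hje, h.radial.mem_arc_iff (by lia) le_rfl] at h2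
  lia

theorem card_arc_left_le (h : Fan H Y x M q k k') {i : ℕ} (hi : i ≤ 2 * k' + 1) :
    (edgesIn H (arc q 0 i)).card ≤ k := by
  have hle := h.le
  calc (edgesIn H (arc q 0 i)).card ≤ (edgesIn H (arc q 0 (2 * k))).card := ?_
    _ = k := h.card_left
  refine Finset.card_le_card fun f hf => ?_
  have hsub := h.radial.arc_subset (i := 0) (j := i) (by lia)
  have hx : x ∉ f := fun hx => h.radial.x_notMem_arc (by lia) ((mem_edgesIn.mp hf).2 x hx)
  refine (h.cases_of_notMem (edgesIn_mono hsub hf) hx).resolve_right fun hl => ?_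
  have h1 := (mem_edgesIn.mp hl).2 _ (Sym2.out_fst_mem f)
  have h2 := (mem_edgesIn.mp hf).2 _ (Sym2.out_fst_mem f)
  obtain ⟨j, -, hj, hje⟩ := mem_arc.mp h2
  rw [← hje, h.radial.mem_arc_iff (by lia) le_rfl] at h1
  lia

theorem card_insert_arc (h : Fan H Y x M q k k') (hb : Blocker H Y (M + 1)) {j : ℕ} (hkj : k < j)
    (hjk : j < k') : (edgesIn H (insert x (arc q 0 (2 * j)))).card = j := by
  have hr := h.radial
  have hle := h.le
  have hins : ∀ i i', i' ≤ 2 * M + 1 → (insert x (arc q i i')).card = i' - i + 1 ∧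
      insert x (arc q i i') ⊆ Y := fun i i' hi' =>
    ⟨by rw [Finset.card_insert_of_notMem (hr.x_notMem_arc hi'), hr.card_arc hi'],
      Finset.insert_subset hr.x_mem (hr.arc_subset hi')⟩
  have hl : j ≤ (edgesIn H (insert x (arc q 0 (2 * j)))).card := by
    by_contra! hlt
    obtain ⟨h1, h2⟩ := hins 0 (2 * j - 1) (by lia)
    refine hb.notMatchable (hr.matchable_of_insert_arc (i := 2 * j - 1) (by lia) ?_ ?_)
    · refine hb.light _ h2 j (by lia) (Or.inr (lt_of_le_of_lt (Finset.card_le_card ?_) hlt))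
      exact edgesIn_mono (Finset.insert_subset_insert _ (arc_mono le_rfl (by lia)))
    · have h3 := h.card_arc_right_le (i := 2 * j - 1) (by lia)
      have h4 := hr.card_arc (i := 2 * j - 1) le_rfl
      exact hb.light _ (hr.arc_subset le_rfl) (M + 1 - j) (by lia) (by lia)
  have hrr : M - j ≤ (edgesIn H (insert x (arc q (2 * j + 1) (2 * M + 1)))).card := by
    by_contra! hlt
    obtain ⟨h1, h2⟩ := hins (2 * j + 2) (2 * M + 1) (by lia)
    refine hb.notMatchable (hr.matchable_of_arc_insert (i := 2 * j + 2) (by lia) ?_ ?_)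
    · have h3 := h.card_arc_left_le (i := 2 * j + 2) (by lia)
      have h4 := hr.card_arc (i := 0) (j := 2 * j + 2) (by lia)
      exact hb.light _ (hr.arc_subset (by lia)) (j + 1) (by lia) (by lia)
    · refine hb.light _ h2 (M - j) (by lia) (Or.inr (lt_of_le_of_lt (Finset.card_le_card ?_) hlt))
      exact edgesIn_mono (Finset.insert_subset_insert _ (arc_mono (by lia) le_rfl))
  have hdis : Disjoint (edgesIn H (insert x (arc q 0 (2 * j))))
      (edgesIn H (insert x (arc q (2 * j + 1) (2 * M + 1)))) := by
    refine edgesIn_disjoint hb.diag (z := x) fun w hw hw' => ?_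
    rw [Finset.mem_insert] at hw hw'
    rcases hw with hw | hw
    · exact hw
    rcases hw' with hw' | hw'
    · exact hw'
    obtain ⟨i, -, hi, rfl⟩ := mem_arc.mp hw
    rw [hr.mem_arc_iff (by lia) le_rfl] at hw'
    lia
  have hsub : ∀ i i', i' ≤ 2 * M + 1 → (i' ≤ 2 * j ∨ 2 * j < i) →
      edgesIn H (insert x (arc q i i')) ⊆ (edgesIn H Y).erase s(x, q (2 * j)) := by
    intro i i' hi' hij f hf
    refine Finset.mem_erase.mpr ⟨?_, edgesIn_mono (hins i i' hi').2 hf⟩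
    rintro rfl
    have := (mem_edgesIn.mp hf).2 (q (2 * j)) (by simp)
    rw [Finset.mem_insert, hr.mem_arc_iff (by lia) hi'] at this
    rcases this with h | h
    · exact hr.ne _ (by lia) h
    · lia
  have hsum := card_edgesIn_add_le (hsub 0 (2 * j) (by lia) (by lia))
    (hsub (2 * j + 1) (2 * M + 1) le_rfl (by lia)) hdis
  rw [Finset.card_erase_of_mem (mk_mem_edgesIn.mpr ⟨h.mem_mid j hkj hjk, hr.x_mem,
    hr.mem (by lia)⟩), hb.edges] at hsum
  lia

end Fan

theorem Blocker.card_rightSide {H : Finset (Sym2 Pt)} {Y : Finset Pt} {x y : Pt} {m : ℕ}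
    (h : Blocker H Y m) (hx : IsExt Y x) (hb : Branching H Y x) (hxy : s(x, y) ∈ edgesIn H Y)
    (hy : ∀ f ∈ edgesIn H Y, y ∈ f → f = s(x, y)) :
    (rightSide Y x y).card = 2 * (edgesIn H (insert x (rightSide Y x y))).card := by
  obtain ⟨M, q, k, k', rfl, hM, hfan⟩ := h.exists_fan_of_branching hx hb
  have hr := hfan.radial
  have hle := hfan.le
  have hlt := hfan.lt
  have hyne : ∀ i, i < 2 * M + 1 → s(x, y) = s(x, q i) → y = q i := fun i _ he =>
    Sym2.congr_right.mp he
  have hxn : ∀ i i', i' ≤ 2 * M + 1 → s(x, y) ∉ edgesIn H (arc q i i') := fun i i' hi' hf =>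
    hr.x_notMem_arc hi' ((mem_edgesIn.mp hf).2 x (by simp))
  rcases hfan.cases _ hxy with h' | h' | h' | h' | ⟨j, hj, hj', h'⟩
  · exact absurd h' (hxn _ _ (by lia))
  · exact absurd h' (hxn _ _ (by lia))
  · obtain rfl := hyne 0 (by lia) h'
    rw [hr.rightSide_eq (by lia)]
    have h0 : arc q 0 0 = ∅ := by simp [arc]
    have hd := edgesIn_disjoint h.diag (S := insert x ∅) (T := insert x ∅) (z := x) (by simp)
    rw [Finset.disjoint_self_iff_empty] at hd
    rw [h0, hd]
    rfl
  · obtain rfl := hyne (2 * M) (by lia) h'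
    rw [hr.rightSide_eq (by lia), hr.card_arc (by lia)]
    have heq : edgesIn H (insert x (arc q 0 (2 * M))) =
        (edgesIn H Y).erase s(x, q (2 * M)) := by
      ext f
      rw [Finset.mem_erase]
      constructor
      · intro hf
        refine ⟨?_, edgesIn_mono (Finset.insert_subset hr.x_mem (hr.arc_subset (by lia))) hf⟩
        rintro rfl
        have := (mem_edgesIn.mp hf).2 (q (2 * M)) (by simp)
        rw [Finset.mem_insert, hr.mem_arc_iff (by lia) (by lia)] at this
        rcases this with h | h
        · exact hr.ne _ (by lia) h
        · lia
      · rintro ⟨hne, hf⟩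
        refine mem_edgesIn.mpr ⟨(mem_edgesIn.mp hf).1, fun w hw => ?_⟩
        obtain rfl | ⟨i, hi, rfl⟩ := (hr.mem_iff w).mp ((mem_edgesIn.mp hf).2 w hw)
        · simp
        · have : i ≠ 2 * M := by
            rintro rfl
            exact hne (hy f hf hw)
          exact Finset.mem_insert_of_mem (mem_arc.mpr ⟨i, by lia, by lia, rfl⟩)
    rw [heq, Finset.card_erase_of_mem hxy, h.edges]
    lia
  · obtain rfl := hyne (2 * j) (by lia) h'
    rw [hr.rightSide_eq (by lia), hr.card_arc (by lia), hfan.card_insert_arc h hj hj']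
    lia

theorem Blocker.branching_or {H : Finset (Sym2 Pt)} {Y : Finset Pt} {u v : Pt} {m : ℕ}
    (h : Blocker H Y m) (hm : 2 ≤ m) (hu : IsExt Y u) (huv : s(u, v) ∈ edgesIn H Y)
    (h1 : ¬ HullEdge Y u v) (h2 : ¬ HullEdge Y v u) : Branching H Y u ∨ Branching H Y v := by
  by_contra! hcon
  have hY := h.card
  have hun : ∀ f ∈ edgesIn H Y, u ∈ f → f = s(u, v) := fun f hf hf' => by
    by_contra hne
    exact hcon.1 ⟨f, hf, _, huv, hne, hf', by simp⟩
  have hvn : ∀ f ∈ edgesIn H Y, v ∈ f → f = s(u, v) := fun f hf hf' => by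
    by_contra hne
    exact hcon.2 ⟨f, hf, _, huv, hne, hf', by simp⟩
  obtain ⟨M, rfl⟩ : ∃ M, m = M + 1 := ⟨m - 1, by lia⟩
  obtain ⟨q, hq⟩ := hu.exists_radial h.gp (N := 2 * M + 1) (by lia)
  have hqi : ∀ i < 2 * M + 1, s(u, q i) ∈ H → q i = v := fun i hi hmem =>
    Sym2.congr_right.mp (hun _ (mk_mem_edgesIn.mpr ⟨hmem, hq.x_mem, hq.mem hi⟩) (by simp))
  have hv0 : q 0 ≠ v := fun he => h1 (he ▸ hq.hullEdge_zero (by lia))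
  have hvM : q (2 * M) ≠ v := fun he => h2 (he ▸ hq.hullEdge_last)
  have hexM : 1 ≤ M ∧ M ≤ (edgesIn H (arc q 0 (2 * M))).card := by
    refine ⟨by lia, ?_⟩
    by_contra! hlt
    have hc := hq.card_arc (i := 0) (j := 2 * M) (by lia)
    have hc' := hq.card_arc (i := 2 * M + 1) (j := 2 * M + 1) (by lia)
    refine h.notMatchable (hq.matchable_of_pair (i := 2 * M) (by lia)
      (fun hmem => hvM (hqi _ (by lia) hmem)) ?_ ?_)
    · exact h.light _ (hq.arc_subset (by lia)) M hc (Or.inr hlt)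
    · exact h.light _ (hq.arc_subset (by lia)) 0 (by lia) (Or.inl rfl)
  have hex : ∃ k, 1 ≤ k ∧ k ≤ (edgesIn H (arc q 0 (2 * k))).card := ⟨M, hexM⟩
  obtain ⟨k', ⟨hk'1, hk'⟩, hmin⟩ : ∃ k', (1 ≤ k' ∧ k' ≤ (edgesIn H (arc q 0 (2 * k'))).card) ∧
      ∀ j < k', ¬ (1 ≤ j ∧ j ≤ (edgesIn H (arc q 0 (2 * j))).card) :=
    ⟨Nat.find hex, Nat.find_spec hex, fun j hj => Nat.find_min hex hj⟩
  have hk'M : k' ≤ M := by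
    by_contra! hlt
    exact hmin M hlt hexM
  obtain ⟨k, rfl⟩ : ∃ k, k' = k + 1 := ⟨k' - 1, by lia⟩
  have hk := hmin k (by lia)
  have hLc := hq.card_arc (i := 0) (j := 2 * k) (by lia)
  have hLm : Matchable H (arc q 0 (2 * k)) :=
    h.light _ (hq.arc_subset (by lia)) k hLc (by lia)
  have hR : M - k ≤ (edgesIn H (arc q (2 * k + 1) (2 * M + 1))).card := by
    by_contra! hlt
    have hc := hq.card_arc (i := 2 * k + 1) (j := 2 * M + 1) (by lia)
    have hv : q (2 * k) = v := by
      by_contra hne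
      refine h.notMatchable (hq.matchable_of_pair (i := 2 * k) (by lia)
        (fun hmem => hne (hqi _ (by lia) hmem)) hLm ?_)
      exact h.light _ (hq.arc_subset (by lia)) (M - k) (by lia) (Or.inr hlt)
    have hxn := hq.x_notMem_arc (i := 2 * k) le_rfl
    have hsub : insert u (arc q (2 * k) (2 * M + 1)) ⊆ Y :=
      Finset.insert_subset hq.x_mem (hq.arc_subset le_rfl)
    refine h.notMatchable (hq.matchable_of_arc_insert (i := 2 * k) (by lia) hLm ?_)
    refine h.light _ hsub (M - k + 1) ?_ (Or.inr ?_)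
    · rw [Finset.card_insert_of_notMem hxn, hq.card_arc le_rfl]
      lia
    · have hle : edgesIn H (insert u (arc q (2 * k) (2 * M + 1))) ⊆
          insert s(u, v) (edgesIn H (arc q (2 * k + 1) (2 * M + 1))) := by
        intro f hf
        have hf' := edgesIn_mono hsub hf
        rw [Finset.mem_insert]
        by_cases hfe : f = s(u, v)
        · exact Or.inl hfe
        refine Or.inr (mem_edgesIn.mpr ⟨(mem_edgesIn.mp hf).1, fun w hw => ?_⟩)
        have hw' := (mem_edgesIn.mp hf).2 w hw
        rw [Finset.mem_insert, mem_arc] at hw'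
        rcases hw' with rfl | ⟨i, hi, hi', rfl⟩
        · exact absurd (hun f hf' hw) hfe
        · have : i ≠ 2 * k := by
            rintro rfl
            exact hfe (hvn f hf' (hv ▸ hw))
          exact mem_arc.mpr ⟨i, by lia, hi', rfl⟩
      have := (Finset.card_le_card hle).trans (Finset.card_insert_le _ _)
      lia
  have hx : ∀ i j, j ≤ 2 * M + 1 → edgesIn H (arc q i j) ⊆ (edgesIn H Y).erase s(u, v) := by
    intro i j hj f hf
    refine Finset.mem_erase.mpr ⟨?_, edgesIn_mono (hq.arc_subset hj) hf⟩
    rintro rfl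
    exact hq.x_notMem_arc hj ((mem_edgesIn.mp hf).2 u (by simp))
  have hsum := card_edgesIn_add_le (hx 0 (2 * (k + 1)) (by lia)) (hx (2 * k + 1) _ le_rfl)
    (hq.edgesIn_arc_disjoint h.diag (i := 0) (j := 2 * (k + 1)) (i' := 2 * k + 1) le_rfl (by lia)
      (by lia))
  rw [Finset.card_erase_of_mem huv, h.edges] at hsum
  lia

/-- Two disjoint sets `A`, `B` of points next to the branching extreme point `x` such that every
edge not at `x` lies in one of them, while an edge at `x` leads to its hull neighbours `s`, `p` or
to a leaf outside `A` and `B`. -/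
structure Wings (H : Finset (Sym2 Pt)) (X : Finset Pt) (x : Pt) (A B : Finset Pt)
    (s p : Pt) : Prop where
  hull_s : HullEdge X x s
  hull_p : HullEdge X p x
  s_mem : s ∈ A
  p_mem : p ∈ B
  notMem_A : x ∉ A
  notMem_B : x ∉ B
  disj : ∀ w ∈ A, w ∉ B
  edge_s : s(x, s) ∈ edgesIn H X
  edge_p : s(x, p) ∈ edgesIn H X
  cases : ∀ f ∈ edgesIn H X, (∀ w ∈ f, w ∈ A) ∨ (∀ w ∈ f, w ∈ B) ∨ x ∈ f
  eq_s : ∀ w ∈ A, s(x, w) ∈ edgesIn H X → w = s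
  eq_p : ∀ w ∈ B, s(x, w) ∈ edgesIn H X → w = p
  leaf_A : ∀ y, s(x, y) ∈ edgesIn H X → y ≠ s → y ≠ p → ∀ w ∈ A, cross x y w < 0
  leaf_B : ∀ y, s(x, y) ∈ edgesIn H X → y ≠ s → y ≠ p → ∀ w ∈ B, 0 < cross x y w
  leaf_unique : ∀ y, s(x, y) ∈ edgesIn H X → y ≠ s → y ≠ p → ∀ f ∈ edgesIn H X, y ∈ f →
    f = s(x, y)
  leaf_exit : ∀ y, s(x, y) ∈ edgesIn H X → y ≠ s → y ≠ p → ∃ a ∈ rightSide X x y, IsExt X a ∧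
    ¬ Touched H X a ∧ ∃ m, Blocker H ((insert x (rightSide X x y)).erase a) m

theorem Fan.exists_exit {H : Finset (Sym2 Pt)} {X : Finset Pt} {x : Pt} {M k k' j : ℕ}
    {q : ℕ → Pt} (h : Fan H X x M q k k') (hb : Blocker H X (M + 1)) (hkj : k < j) (hjk : j < k') :
    ∃ a ∈ arc q 0 (2 * j), IsExt X a ∧ ¬ Touched H X a ∧
      Blocker H ((insert x (arc q 0 (2 * j))).erase a) j := by
  have hr := h.radial
  have hle := h.le
  obtain ⟨a, ha, b, hbm, hab⟩ := hr.exists_hullEdge hb.gp (i := 2 * j) (by lia) (by lia)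
  obtain ⟨i, -, hi, rfl⟩ := mem_arc.mp ha
  obtain ⟨l, hl, hl', rfl⟩ := mem_arc.mp hbm
  have hn : s(q i, q l) ∉ H := by
    intro hmem
    have hx : x ∉ s(q i, q l) := by
      intro hx
      rcases Sym2.mem_iff.mp hx with hx | hx
      · exact hr.ne i (by lia) hx.symm
      · exact hr.ne l (by lia) hx.symm
    rcases h.cases_of_notMem (mk_mem_edgesIn.mpr ⟨hmem, hab.1, hab.2.1⟩) hx with h' | h'
    · have := (hr.mem_arc_iff (by lia) (by lia)).mp ((mem_edgesIn.mp h').2 (q l) (by simp))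
      lia
    · have := (hr.mem_arc_iff (by lia) (by lia)).mp ((mem_edgesIn.mp h').2 (q i) (by simp))
      lia
  have hcL := hr.card_arc (i := 0) (j := 2 * j) (by lia)
  have hcR := hr.card_arc (i := 2 * j) (j := 2 * M + 1) le_rfl
  have hxL := hr.x_notMem_arc (i := 0) (j := 2 * j) (by lia)
  have hins : insert x (arc q 0 (2 * j)) ⊆ X :=
    Finset.insert_subset hr.x_mem (hr.arc_subset (by lia))
  have hYc : ((insert x (arc q 0 (2 * j))).erase (q i)).card = 2 * j := by
    rw [Finset.card_erase_of_mem (Finset.mem_insert_of_mem ha), Finset.card_insert_of_notMem hxL,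
      hcL]
    lia
  have hYn : ¬ Matchable H ((insert x (arc q 0 (2 * j))).erase (q i)) := by
    intro hmat
    refine hb.notMatchable (hab.matchable hn ?_)
    have hrest : Matchable H ((arc q (2 * j) (2 * M + 1)).erase (q l)) := by
      refine hb.light _ ((Finset.erase_subset _ _).trans (hr.arc_subset le_rfl)) (M - j) ?_
        (Or.inr ?_)
      · rw [Finset.card_erase_of_mem hbm, hcR]
        lia
      · have h1 := Finset.card_le_card (edgesIn_mono (H := H)
          (Finset.erase_subset (q l) (arc q (2 * j) (2 * M + 1))))
        have h2 := h.card_arc_right_le (i := 2 * j) (by lia)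
        lia
    convert hmat.union hrest ((hr.strictSep_insert_arc (i := 2 * j) (by lia)).mono
      (Finset.erase_subset _ _) (Finset.erase_subset _ _)) using 1
    ext w
    simp only [Finset.mem_erase, Finset.mem_union, Finset.mem_insert]
    constructor
    · rintro ⟨h1, h2, h3⟩
      obtain rfl | ⟨n, hn, rfl⟩ := (hr.mem_iff w).mp h3
      · exact Or.inl ⟨h2, Or.inl rfl⟩
      · rcases lt_or_ge n (2 * j) with hnj | hnj
        · exact Or.inl ⟨h2, Or.inr (mem_arc.mpr ⟨n, by lia, hnj, rfl⟩)⟩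
        · exact Or.inr ⟨h1, mem_arc.mpr ⟨n, hnj, hn, rfl⟩⟩
    · rintro (⟨h1, rfl | h2⟩ | ⟨h1, h2⟩)
      · exact ⟨(hr.ne l hl').symm, h1, hr.x_mem⟩
      · obtain ⟨n, -, hn, rfl⟩ := mem_arc.mp h2
        refine ⟨fun he => ?_, h1, hr.mem (by lia)⟩
        have := hr.inj (by lia) (by lia) he
        lia
      · obtain ⟨n, hn, hn', rfl⟩ := mem_arc.mp h2
        refine ⟨h1, fun he => ?_, hr.mem (by lia)⟩
        have := hr.inj (by lia) (by lia) he
        lia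
  have hYe := h.card_insert_arc hb hkj hjk
  have hYsub := edgesIn_mono (H := H) (Finset.erase_subset (q i) (insert x (arc q 0 (2 * j))))
  have hYb := hb.of_subset ((Finset.erase_subset _ _).trans hins) hYc
    ((Finset.card_le_card hYsub).trans hYe.le) hYn
  have heq := Finset.eq_of_subset_of_card_le hYsub (by rw [hYe, hYb.edges])
  refine ⟨q i, ha, hab.isExt_left, ?_, hYb⟩
  rintro ⟨f, hf, hif⟩
  have hno : f ∉ edgesIn H (insert x (arc q 0 (2 * j))) := by
    rw [← heq]
    intro hf'
    simpa using (mem_edgesIn.mp hf').2 _ hif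
  have hxi : ∀ n, f = s(x, q n) → i = n ∨ ¬ n < 2 * M + 1 := by
    rintro n rfl
    by_cases hn : n < 2 * M + 1
    · rcases Sym2.mem_iff.mp hif with he | he
      · exact absurd he (hr.ne i (by lia))
      · exact Or.inl (hr.inj (by lia) hn he)
    · exact Or.inr hn
  have hin : ∀ n, n < 2 * j → f ≠ s(x, q n) := by
    rintro n hn rfl
    refine hno (mk_mem_edgesIn.mpr ⟨(mem_edgesIn.mp hf).1, by simp, ?_⟩)
    exact Finset.mem_insert_of_mem (mem_arc.mpr ⟨n, by lia, hn, rfl⟩)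
  rcases h.cases f hf with h' | h' | h' | h' | ⟨n, hn, hn', h'⟩
  · exact hno (edgesIn_mono ((arc_mono le_rfl (by lia)).trans (Finset.subset_insert _ _)) h')
  · have := (hr.mem_arc_iff (by lia) le_rfl).mp ((mem_edgesIn.mp h').2 _ hif)
    lia
  · exact hin 0 (by lia) h'
  · have := hxi _ h'
    lia
  · have := hxi _ h'
    exact hin (2 * n) (by lia) h'

theorem Blocker.exists_wings {H : Finset (Sym2 Pt)} {X : Finset Pt} {x : Pt} {m : ℕ}
    (hb : Blocker H X m) (hx : IsExt X x) (hbr : Branching H X x) :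
    ∃ A B s p, Wings H X x A B s p := by
  obtain ⟨M, q, k, k', rfl, hM, h⟩ := hb.exists_fan_of_branching hx hbr
  have hr := h.radial
  have hle := h.le
  have hlt := h.lt
  have hxn : ∀ w i i', i' ≤ 2 * M + 1 → s(x, w) ∉ edgesIn H (arc q i i') := fun w i i' hi' hf =>
    hr.x_notMem_arc hi' ((mem_edgesIn.mp hf).2 x (by simp))
  have hedge : ∀ w, s(x, w) ∈ edgesIn H X →
      w = q 0 ∨ w = q (2 * M) ∨ ∃ j, k < j ∧ j < k' ∧ w = q (2 * j) := by
    intro w hw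
    rcases h.cases _ hw with h' | h' | h' | h' | ⟨j, hj, hj', h'⟩
    · exact absurd h' (hxn _ _ _ (by lia))
    · exact absurd h' (hxn _ _ _ (by lia))
    · exact Or.inl (Sym2.congr_right.mp h')
    · exact Or.inr (Or.inl (Sym2.congr_right.mp h'))
    · exact Or.inr (Or.inr ⟨j, hj, hj', Sym2.congr_right.mp h'⟩)
  have hleaf : ∀ w, s(x, w) ∈ edgesIn H X → w ≠ q 0 → w ≠ q (2 * M) →
      ∃ j, k < j ∧ j < k' ∧ w = q (2 * j) := fun w hw h0 h1 =>
    ((hedge w hw).resolve_left h0).resolve_left h1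
  refine ⟨arc q 0 (max 1 (2 * k)), arc q (min (2 * M) (2 * k' + 1)) (2 * M + 1), q 0, q (2 * M),
    hr.hullEdge_zero (by lia), hr.hullEdge_last, mem_arc.mpr ⟨0, by lia, by lia, rfl⟩,
    mem_arc.mpr ⟨2 * M, by lia, by lia, rfl⟩, hr.x_notMem_arc (by lia), hr.x_notMem_arc (by lia),
    ?_, mk_mem_edgesIn.mpr ⟨h.mem_zero, hr.x_mem, hr.mem (by lia)⟩,
    mk_mem_edgesIn.mpr ⟨h.mem_last, hr.x_mem, hr.mem (by lia)⟩, ?_, ?_, ?_, ?_, ?_, ?_, ?_⟩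
  · intro w hw hw'
    obtain ⟨i, -, hi, rfl⟩ := mem_arc.mp hw
    rw [hr.mem_arc_iff (by lia) le_rfl] at hw'
    lia
  · intro f hf
    by_cases hxf : x ∈ f
    · exact Or.inr (Or.inr hxf)
    rcases h.cases_of_notMem hf hxf with h' | h'
    · exact Or.inl fun w hw => arc_mono le_rfl (by lia) ((mem_edgesIn.mp h').2 w hw)
    · exact Or.inr (Or.inl fun w hw => arc_mono (by lia) le_rfl ((mem_edgesIn.mp h').2 w hw))
  · intro w hw hf
    rcases hedge w hf with h' | rfl | ⟨j, hj, hj', rfl⟩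
    · exact h'
    · rw [hr.mem_arc_iff (by lia) (by lia)] at hw
      lia
    · rw [hr.mem_arc_iff (by lia) (by lia)] at hw
      lia
  · intro w hw hf
    rcases hedge w hf with rfl | h' | ⟨j, hj, hj', rfl⟩
    · rw [hr.mem_arc_iff (by lia) (by lia)] at hw
      lia
    · exact h'
    · rw [hr.mem_arc_iff (by lia) (by lia)] at hw
      lia
  · intro y hy hs hp w hw
    obtain ⟨j, hj, hj', rfl⟩ := hleaf y hy hs hp
    obtain ⟨i, -, hi, rfl⟩ := mem_arc.mp hw
    exact hr.neg (by lia) (by lia)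
  · intro y hy hs hp w hw
    obtain ⟨j, hj, hj', rfl⟩ := hleaf y hy hs hp
    obtain ⟨i, hi, hi', rfl⟩ := mem_arc.mp hw
    exact hr.pos _ _ (by lia) (by lia)
  · intro y hy hs hp f hf hyf
    obtain ⟨j, hj, hj', rfl⟩ := hleaf y hy hs hp
    have hxf : x ∈ f := by
      by_contra hxf
      rcases h.cases_of_notMem hf hxf with h' | h' <;>
      · have := (mem_edgesIn.mp h').2 _ hyf
        rw [hr.mem_arc_iff (by lia) (by lia)] at this
        lia
    exact (Sym2.mem_and_mem_iff (hr.ne _ (by lia)).symm).mp ⟨hxf, hyf⟩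
  · intro y hy hs hp
    obtain ⟨j, hj, hj', rfl⟩ := hleaf y hy hs hp
    rw [hr.rightSide_eq (by lia)]
    obtain ⟨a, h1, h2, h3, h4⟩ := h.exists_exit hb hj hj'
    exact ⟨a, h1, h2, h3, j, h4⟩

/-- The combinatorial part of a family of `Wings`, symmetric under exchanging both sides. -/
structure WingSystem (F : Finset (Sym2 Pt)) (E : Set Pt) (A B : Pt → Finset Pt)
    (s p : Pt → Pt) : Prop where
  conn : ∀ S : Set Pt, (∀ f ∈ F, (∀ w ∈ f, w ∈ S) ∨ ∀ w ∈ f, w ∉ S) →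
    (∀ f ∈ F, ∀ w ∈ f, w ∈ S) ∨ ∀ f ∈ F, ∀ w ∈ f, w ∉ S
  s_mem : ∀ x ∈ E, s x ∈ A x
  p_mem : ∀ x ∈ E, p x ∈ B x
  notMem_A : ∀ x ∈ E, x ∉ A x
  notMem_B : ∀ x ∈ E, x ∉ B x
  disj : ∀ x ∈ E, ∀ w ∈ A x, w ∉ B x
  edge_s : ∀ x ∈ E, s(x, s x) ∈ F
  edge_p : ∀ x ∈ E, s(x, p x) ∈ F
  cases : ∀ x ∈ E, ∀ f ∈ F, (∀ w ∈ f, w ∈ A x) ∨ (∀ w ∈ f, w ∈ B x) ∨ x ∈ f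
  eq_s : ∀ x ∈ E, ∀ w ∈ A x, s(x, w) ∈ F → w = s x
  eq_p : ∀ x ∈ E, ∀ w ∈ B x, s(x, w) ∈ F → w = p x
  s_p : ∀ x ∈ E, p x ∈ E → s (p x) = x
  p_s : ∀ x ∈ E, s x ∈ E → p (s x) = x
  mem_of_s : ∀ x ∈ E, ∀ f ∈ F, s x ∈ f → f = s(x, s x) ∨ s x ∈ E
  mem_of_p : ∀ x ∈ E, ∀ f ∈ F, p x ∈ f → f = s(x, p x) ∨ p x ∈ E

namespace WingSystem

variable {F : Finset (Sym2 Pt)} {E : Set Pt} {A B : Pt → Finset Pt} {s p : Pt → Pt}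

theorem swap (h : WingSystem F E A B s p) : WingSystem F E B A p s where
  conn := h.conn
  s_mem := h.p_mem
  p_mem := h.s_mem
  notMem_A := h.notMem_B
  notMem_B := h.notMem_A
  disj := fun x hx w hw hw' => h.disj x hx w hw' hw
  edge_s := h.edge_p
  edge_p := h.edge_s
  cases := fun x hx f hf => by
    rcases h.cases x hx f hf with h' | h' | h'
    · exact Or.inr (Or.inl h')
    · exact Or.inl h'
    · exact Or.inr (Or.inr h')
  eq_s := h.eq_p
  eq_p := h.eq_s
  s_p := h.p_s
  p_s := h.s_p
  mem_of_s := h.mem_of_p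
  mem_of_p := h.mem_of_s

theorem forall_notMem (h : WingSystem F E A B s p) {x : Pt} (hx : x ∈ E) {S : Set Pt}
    (hxS : x ∉ S) (hS : ∀ f ∈ F, ∀ a ∈ f, a ∈ S → ∀ w ∈ f, w ∈ S) :
    ∀ f ∈ F, ∀ w ∈ f, w ∉ S := by
  refine (h.conn S fun f hf => ?_).resolve_left fun hall =>
    hxS (hall _ (h.edge_s x hx) x (Sym2.mem_mk_left _ _))
  by_cases hex : ∃ a ∈ f, a ∈ S
  · obtain ⟨a, ha, haS⟩ := hex
    exact Or.inl (hS f hf a ha haS)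
  · push Not at hex
    exact Or.inr hex

theorem mem_or_mem (h : WingSystem F E A B s p) {x x' : Pt} (hx : x ∈ E) (hx' : x' ∈ E)
    (hne : x ≠ x') : x' ∈ A x ∨ x' ∈ B x := by
  by_contra! hcon
  have key : ∀ w, s(x', w) ∈ F → w = x := by
    intro w hw
    rcases h.cases x hx _ hw with h' | h' | h'
    · exact absurd (h' x' (by simp)) hcon.1
    · exact absurd (h' x' (by simp)) hcon.2
    · exact ((Sym2.mem_iff.mp h').resolve_left hne).symm
  have h1 := key _ (h.edge_s x' hx')
  have h2 := key _ (h.edge_p x' hx')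
  exact h.disj x' hx' _ (h.s_mem x' hx') (by rw [h1, ← h2]; exact h.p_mem x' hx')

/-- No two points of `E` lie in each other's `B`-side. -/
theorem notMem_of_mem (h : WingSystem F E A B s p) {x x' : Pt} (hx : x ∈ E) (hx' : x' ∈ E)
    (h1 : x' ∈ B x) : x ∉ B x' := by
  intro h2
  induction hn : (edgesIn F (B x)).card using Nat.strong_induction_on generalizing x with
  | _ n ih =>
  have hne : x ≠ x' := by
    rintro rfl
    exact h.notMem_B x hx h1
  have hpx : p x ≠ x' := by
    rintro rfl
    have := h.s_mem _ hx'
    rw [h.s_p x hx hx'] at this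
    exact h.disj _ hx' _ this h2
  have hpE : p x ∈ E := by
    by_contra hpE
    refine h.forall_notMem hx (S := {w | w ∈ B x ∧ w ≠ p x}) (fun hxS => h.notMem_B x hx hxS.1) ?_
      _ (h.edge_s x' hx') x' (by simp) ⟨h1, hpx.symm⟩
    rintro f hf a haf ⟨haB, hap⟩ w hw
    rcases h.cases x hx f hf with h' | h' | h'
    · exact absurd haB (h.disj x hx a (h' a haf))
    · refine ⟨h' w hw, ?_⟩
      rintro rfl
      have := (h.mem_of_p x hx f hf hw).resolve_right hpE
      exact h.notMem_B x hx (h' x (by rw [this]; simp))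
    · have hax : x ≠ a := by
        rintro rfl
        exact h.notMem_B x hx haB
      rw [(Sym2.mem_and_mem_iff hax).mp ⟨h', haf⟩] at hf
      exact absurd (h.eq_p x hx a haB hf) hap
  have hsp := h.s_p x hx hpE
  have hpB := h.p_mem x hx
  have hxA : x ∈ A (p x) := by
    have := h.s_mem _ hpE
    rwa [hsp] at this
  have hx'B : x' ∈ B (p x) := by
    refine (h.mem_or_mem hpE hx' hpx).resolve_left fun hx'A => ?_
    refine h.forall_notMem hx (S := {w | w ∈ A (p x) ∧ w ∈ B x})
      (fun hxS => h.notMem_B x hx hxS.2) ?_ _ (h.edge_s x' hx') x' (by simp) ⟨hx'A, h1⟩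
    rintro f hf a haf ⟨haA, haB⟩ w hw
    rcases h.cases (p x) hpE f hf with h' | h' | h'
    · rcases h.cases x hx f hf with h'' | h'' | h''
      · exact absurd haB (h.disj x hx a (h'' a haf))
      · exact ⟨h' w hw, h'' w hw⟩
      · have hax : x ≠ a := by
          rintro rfl
          exact h.notMem_B x hx haB
        rw [(Sym2.mem_and_mem_iff hax).mp ⟨h'', haf⟩] at hf
        rw [h.eq_p x hx a haB hf] at haA
        exact absurd haA (h.notMem_A _ hpE)
    · exact absurd (h' a haf) (h.disj _ hpE a haA)
    · have hax : p x ≠ a := by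
        rintro rfl
        exact h.notMem_A _ hpE haA
      rw [(Sym2.mem_and_mem_iff hax).mp ⟨h', haf⟩] at hf
      rw [h.eq_s _ hpE a haA hf, hsp] at haB
      exact absurd haB (h.notMem_B x hx)
  have hpB' : p x ∈ B x' := by
    rcases h.cases x' hx' _ (h.edge_p x hx) with h' | h' | h'
    · exact absurd h2 (h.disj x' hx' x (h' x (by simp)))
    · exact h' _ (by simp)
    · rcases Sym2.mem_iff.mp h' with h' | h'
      · exact absurd h'.symm hne
      · exact absurd h'.symm hpx
  have hout := h.forall_notMem hx (S := {w | w ∈ A x ∧ w ∈ B (p x)})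
    (fun hxS => h.notMem_A x hx hxS.1) (by
      rintro f hf a haf ⟨haA, haB⟩ w hw
      rcases h.cases x hx f hf with h' | h' | h'
      · rcases h.cases (p x) hpE f hf with h'' | h'' | h''
        · exact absurd haB (h.disj _ hpE a (h'' a haf))
        · exact ⟨h' w hw, h'' w hw⟩
        · exact absurd hpB (h.disj x hx _ (h' _ h''))
      · exact absurd (h' a haf) (h.disj x hx a haA)
      · have hax : x ≠ a := by
          rintro rfl
          exact h.notMem_A x hx haA
        obtain rfl := (Sym2.mem_and_mem_iff hax).mp ⟨h', haf⟩
        rcases h.cases (p x) hpE _ hf with h'' | h'' | h''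
        · exact absurd haB (h.disj _ hpE a (h'' a haf))
        · exact absurd (h'' x h') (h.disj _ hpE x hxA)
        · rcases Sym2.mem_iff.mp h'' with h'' | h''
          · rw [h''] at hpB
            exact absurd hpB (h.notMem_B x hx)
          · rw [h''] at hpB
            exact absurd hpB (h.disj x hx a haA))
  have hlt : edgesIn F (B (p x)) ⊂ edgesIn F (B x) := by
    refine ⟨fun f hf => ?_, fun hsub => ?_⟩
    · rw [mem_edgesIn] at hf ⊢
      refine ⟨hf.1, ?_⟩
      rcases h.cases x hx f hf.1 with h' | h' | h'
      · have hm := Sym2.out_fst_mem f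
        exact absurd ⟨h' _ hm, hf.2 _ hm⟩ (hout f hf.1 _ hm)
      · exact h'
      · exact absurd (hf.2 x h') (h.disj _ hpE x hxA)
    · have hmem : s(p x, p (p x)) ∈ edgesIn F (B x) := by
        refine mem_edgesIn.mpr ⟨h.edge_p _ hpE, ?_⟩
        rcases h.cases x hx _ (h.edge_p _ hpE) with h' | h' | h'
        · exact absurd hpB (h.disj x hx _ (h' _ (by simp)))
        · exact h'
        · have hpp := h.p_mem _ hpE
          rcases Sym2.mem_iff.mp h' with h'' | h''
          · rw [← h''] at hpB
            exact absurd hpB (h.notMem_B x hx)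
          · rw [← h''] at hpp
            exact absurd hpp (h.disj _ hpE x hxA)
      exact h.notMem_B _ hpE ((mem_edgesIn.mp (hsub hmem)).2 _ (by simp))
  exact ih _ (hn ▸ Finset.card_lt_card hlt) hpE hx'B hpB' rfl

end WingSystem
/-- The extreme points of `X` that lie on at least two edges of `H`. -/
def branchPoints (H : Finset (Sym2 Pt)) (X : Finset Pt) : Set Pt :=
  {x | IsExt X x ∧ Branching H X x}

/-- The wings of all the points of `branchPoints H X`, chosen simultaneously. -/
structure WingChoice (H : Finset (Sym2 Pt)) (X : Finset Pt) (A B : Pt → Finset Pt)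
    (s p : Pt → Pt) : Prop where
  wings : ∀ x ∈ branchPoints H X, Wings H X x (A x) (B x) (s x) (p x)
  system : WingSystem (edgesIn H X) (branchPoints H X) A B s p

theorem Blocker.exists_wingChoice {H : Finset (Sym2 Pt)} {X : Finset Pt} {m : ℕ}
    (hb : Blocker H X m) : ∃ A B s p, WingChoice H X A B s p := by
  have h : ∀ x, ∃ A B s p, x ∈ branchPoints H X → Wings H X x A B s p := by
    intro x
    by_cases hx : x ∈ branchPoints H X
    · obtain ⟨A, B, s, p, hw⟩ := hb.exists_wings hx.1 hx.2
      exact ⟨A, B, s, p, fun _ => hw⟩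
    · exact ⟨∅, ∅, x, x, fun hx' => absurd hx' hx⟩
  choose A B s p hw using h
  refine ⟨A, B, s, p, hw, ?_⟩
  exact {
    conn := hb.connected_and_card.1
    s_mem := fun x hx => (hw x hx).s_mem
    p_mem := fun x hx => (hw x hx).p_mem
    notMem_A := fun x hx => (hw x hx).notMem_A
    notMem_B := fun x hx => (hw x hx).notMem_B
    disj := fun x hx => (hw x hx).disj
    edge_s := fun x hx => (hw x hx).edge_s
    edge_p := fun x hx => (hw x hx).edge_p
    cases := fun x hx => (hw x hx).cases
    eq_s := fun x hx => (hw x hx).eq_s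
    eq_p := fun x hx => (hw x hx).eq_p
    s_p := fun x hx hp => (hw _ hp).hull_s.right_unique (hw x hx).hull_p
    p_s := fun x hx hs => (hw _ hs).hull_p.left_unique (hw x hx).hull_s
    mem_of_s := fun x hx f hf hs => or_iff_not_imp_left.mpr fun hne =>
      ⟨(hw x hx).hull_s.isExt_right, f, hf, _, (hw x hx).edge_s, hne, hs, by simp⟩
    mem_of_p := fun x hx f hf hp => or_iff_not_imp_left.mpr fun hne =>
      ⟨(hw x hx).hull_p.isExt_left, f, hf, _, (hw x hx).edge_p, hne, hp, by simp⟩ }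

/-- The edge `xy` is a leaf edge at the point `x` of `branchPoints H X`. -/
structure IsLeaf (H : Finset (Sym2 Pt)) (X : Finset Pt) (s p : Pt → Pt) (x y : Pt) : Prop where
  mem : x ∈ branchPoints H X
  edge : s(x, y) ∈ edgesIn H X
  ne_s : y ≠ s x
  ne_p : y ≠ p x

namespace WingChoice

variable {H : Finset (Sym2 Pt)} {X : Finset Pt} {A B : Pt → Finset Pt} {s p : Pt → Pt}
  {x y x' y' : Pt}

theorem cross_neg (h : WingChoice H X A B s p) (hl : IsLeaf H X s p x y) {w : Pt}
    (hw : w ∈ A x) : cross x y w < 0 :=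
  (h.wings x hl.mem).leaf_A y hl.edge hl.ne_s hl.ne_p w hw

theorem cross_pos (h : WingChoice H X A B s p) (hl : IsLeaf H X s p x y) {w : Pt}
    (hw : w ∈ B x) : 0 < cross x y w :=
  (h.wings x hl.mem).leaf_B y hl.edge hl.ne_s hl.ne_p w hw

theorem eq_of_mem (h : WingChoice H X A B s p) (hl : IsLeaf H X s p x y) {f : Sym2 Pt}
    (hf : f ∈ edgesIn H X) (hy : y ∈ f) : f = s(x, y) :=
  (h.wings x hl.mem).leaf_unique y hl.edge hl.ne_s hl.ne_p f hf hy

theorem nested_of_mem (h : WingChoice H X A B s p) (hl : IsLeaf H X s p x y)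
    (hl' : IsLeaf H X s p x' y') (h1 : x' ∈ B x) (h2 : x ∈ A x') :
    edgesIn H (insert y (insert x (rightSide X x y))) ⊆
      edgesIn H (insert x' (rightSide X x' y')) := by
  have hS := h.system
  have hT : ∀ w ∈ insert y (insert x (rightSide X x y)), w ∉ B x := by
    intro w hw hwB
    have hpos := h.cross_pos hl hwB
    rw [Finset.mem_insert, Finset.mem_insert, mem_rightSide] at hw
    rcases hw with rfl | rfl | hw
    · simp [cross_self_right] at hpos
    · exact hS.notMem_B _ hl.mem hwB
    · linarith [hw.2]
  have hxB : x ∉ B x' := hS.disj x' hl'.mem x h2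
  have hxA : x' ∉ A x := fun hA => hS.disj x hl.mem x' hA h1
  have hedge : ∀ f ∈ edgesIn H X, ∀ a ∈ f, a ∈ insert y (insert x (rightSide X x y)) → x ∉ f →
      ∀ w ∈ f, w ∈ A x := by
    intro f hf a ha haT hxf
    rcases hS.cases x hl.mem f hf with hc | hc | hc
    · exact hc
    · exact absurd (hc a ha) (hT a haT)
    · exact absurd hc hxf
  have hdisj := hS.forall_notMem hl.mem
    (S := {w | w ∈ insert y (insert x (rightSide X x y)) ∧ w ∈ B x'}) (fun hx => hxB hx.2) (by
      rintro f hf a ha ⟨haT, haB⟩ w hw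
      rcases hS.cases x' hl'.mem f hf with hc | hc | hc
      · exact absurd haB (hS.disj x' hl'.mem a (hc a ha))
      · have hxf : x ∉ f := fun hx => hxB (hc x hx)
        refine ⟨?_, hc w hw⟩
        rw [Finset.mem_insert, Finset.mem_insert, mem_rightSide]
        exact Or.inr (Or.inr ⟨(mem_edgesIn.mp hf).2 w hw,
          h.cross_neg hl (hedge f hf a ha haT hxf w hw)⟩)
      · by_cases hxf : x ∈ f
        · have hne : x ≠ x' := fun he => hS.notMem_B _ hl.mem (he ▸ h1)
          obtain rfl := (Sym2.mem_and_mem_iff hne).mp ⟨hxf, hc⟩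
          rcases Sym2.mem_iff.mp ha with rfl | rfl
          · exact absurd haB hxB
          · exact absurd haB (hS.notMem_B _ hl'.mem)
        · exact absurd (hedge f hf a ha haT hxf x' hc) hxA)
  intro e he
  obtain ⟨heH, heT⟩ := mem_edgesIn.mp he
  have heX : e ∈ edgesIn H X := by
    refine mem_edgesIn.mpr ⟨heH, fun w hw => ?_⟩
    have hwT := heT w hw
    rw [Finset.mem_insert, Finset.mem_insert, mem_rightSide] at hwT
    rcases hwT with rfl | rfl | hw'
    · exact (mk_mem_edgesIn.mp hl.edge).2.2
    · exact (mk_mem_edgesIn.mp hl.edge).2.1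
    · exact hw'.1
  rcases hS.cases x' hl'.mem e heX with hc | hc | hc
  · refine mem_edgesIn.mpr ⟨heH, fun w hw => Finset.mem_insert_of_mem (mem_rightSide.mpr ?_)⟩
    exact ⟨(mem_edgesIn.mp heX).2 w hw, h.cross_neg hl' (hc w hw)⟩
  · obtain ⟨a, ha⟩ : ∃ a, a ∈ e := ⟨_, Sym2.out_fst_mem e⟩
    exact absurd ⟨heT a ha, hc a ha⟩ (hdisj e heX a ha)
  · exact absurd h1 (hT x' (heT x' hc))

theorem nested_of_cross_pos (hgp : GenPos X) (hl : IsLeaf H X s p x y)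
    (hl' : IsLeaf H X s p x y') (hc : 0 < cross x y y') :
    edgesIn H (insert y (insert x (rightSide X x y))) ⊆
      edgesIn H (insert x (rightSide X x y')) := by
  have hyX := (mk_mem_edgesIn.mp hl.edge).2.2
  have hyX' := (mk_mem_edgesIn.mp hl'.edge).2.2
  have hyy : cross x y' y < 0 := by rw [cross_swap_right]; linarith
  refine edgesIn_mono fun w hw => ?_
  rw [Finset.mem_insert, Finset.mem_insert, mem_rightSide] at hw
  rw [Finset.mem_insert, mem_rightSide]
  rcases hw with rfl | rfl | hw
  · exact Or.inr ⟨hyX, hyy⟩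
  · exact Or.inl rfl
  · refine Or.inr ⟨hw.1, ?_⟩
    have h1 : 0 < cross x w y := by rw [cross_swap_right]; linarith [hw.2]
    have := hl.mem.1.cross_trans hgp hw.1 hyX hyX' h1 hc
    rw [cross_swap_right]
    linarith

theorem nested_or (h : WingChoice H X A B s p) (hgp : GenPos X) (hd : ∀ e ∈ H, ¬ e.IsDiag)
    (hl : IsLeaf H X s p x y) (hl' : IsLeaf H X s p x' y') (hne : y ≠ y') :
    edgesIn H (insert y (insert x (rightSide X x y))) ⊆ edgesIn H (insert x' (rightSide X x' y')) ∨
    edgesIn H (insert y' (insert x' (rightSide X x' y'))) ⊆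
      edgesIn H (insert x (rightSide X x y)) := by
  have hS := h.system
  by_cases hxx : x = x'
  · subst hxx
    obtain ⟨hH, hxX, hyX⟩ := mk_mem_edgesIn.mp hl.edge
    obtain ⟨hH', -, hyX'⟩ := mk_mem_edgesIn.mp hl'.edge
    have hxy : x ≠ y := by simpa using hd _ hH
    have hxy' : x ≠ y' := by simpa using hd _ hH'
    rcases (hgp.cross_ne_zero hxX hyX hyX' hxy hxy' hne).lt_or_gt with hc | hc
    · refine Or.inr (nested_of_cross_pos hgp hl' hl ?_)
      rw [cross_swap_right]; linarith
    · exact Or.inl (nested_of_cross_pos hgp hl hl' hc)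
  · rcases hS.mem_or_mem hl.mem hl'.mem hxx with h1 | h1
    · have h2 := hS.swap.notMem_of_mem hl.mem hl'.mem h1
      have h3 := (hS.mem_or_mem hl'.mem hl.mem (Ne.symm hxx)).resolve_left h2
      exact Or.inr (h.nested_of_mem hl' hl h3 h1)
    · have h2 := hS.notMem_of_mem hl.mem hl'.mem h1
      have h3 := (hS.mem_or_mem hl'.mem hl.mem (Ne.symm hxx)).resolve_right h2
      exact Or.inl (h.nested_of_mem hl hl' h1 h3)

theorem notMem_rightSide_of_nested (h : WingChoice H X A B s p) {m k : ℕ} (hb : Blocker H X m)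
    (hl : IsLeaf H X s p x y) (hl' : IsLeaf H X s p x' y')
    (hn : edgesIn H (insert y (insert x (rightSide X x y))) ⊆
      edgesIn H (insert x' (rightSide X x' y')))
    {a : Pt} (ha : ¬ Touched H X a)
    (hk : Blocker H ((insert x' (rightSide X x' y')).erase a) k) : a ∉ rightSide X x y := by
  have hsub' : insert x' (rightSide X x' y') ⊆ X := by
    intro w hw
    rw [Finset.mem_insert, mem_rightSide] at hw
    rcases hw with rfl | hw
    · exact hl'.mem.1.1
    · exact hw.1
  have hsub : (insert x' (rightSide X x' y')).erase a ⊆ X := (Finset.erase_subset _ _).trans hsub'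
  have herase : edgesIn H (insert x' (rightSide X x' y')) ⊆
      edgesIn H ((insert x' (rightSide X x' y')).erase a) := by
    intro f hf
    have hfX := edgesIn_mono hsub' hf
    refine mem_edgesIn.mpr ⟨(mem_edgesIn.mp hf).1, fun w hw => ?_⟩
    refine Finset.mem_erase.mpr ⟨?_, (mem_edgesIn.mp hf).2 w hw⟩
    rintro rfl
    exact ha ⟨f, hfX, hw⟩
  have hxX := hl.mem.1.1
  have hsX := (h.wings x hl.mem).hull_s.2.1
  have hxy : s(x, y) ∈ edgesIn H ((insert x' (rightSide X x' y')).erase a) :=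
    herase (hn (mk_mem_edgesIn.mpr ⟨(mk_mem_edgesIn.mp hl.edge).1, by simp, by simp⟩))
  have hxs : s(x, s x) ∈ edgesIn H ((insert x' (rightSide X x' y')).erase a) := by
    refine herase (hn (mk_mem_edgesIn.mpr
      ⟨(mk_mem_edgesIn.mp (h.wings x hl.mem).edge_s).1, by simp, ?_⟩))
    have := h.cross_neg hl (h.wings x hl.mem).s_mem
    simp [mem_rightSide, hsX, this]
  have hxY := (mk_mem_edgesIn.mp hxy).2.1
  have hbr : Branching H ((insert x' (rightSide X x' y')).erase a) x :=
    ⟨_, hxy, _, hxs, fun he => hl.ne_s (Sym2.congr_right.mp he), by simp, by simp⟩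
  have hcX := hb.card_rightSide hl.mem.1 hl.mem.2 hl.edge fun f hf hy => h.eq_of_mem hl hf hy
  have hcY := hk.card_rightSide (hl.mem.1.mono hsub hxY) hbr hxy fun f hf hy =>
    h.eq_of_mem hl (edgesIn_mono hsub hf) hy
  have hbe : rightSide ((insert x' (rightSide X x' y')).erase a) x y ⊆
      rightSide X x y := fun w hw => by
    rw [mem_rightSide] at hw ⊢
    exact ⟨hsub hw.1, hw.2⟩
  have hE : edgesIn H (insert x (rightSide X x y)) ⊆
      edgesIn H (insert x (rightSide ((insert x' (rightSide X x' y')).erase a) x y)) := by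
    intro f hf
    have hfY := herase (hn (edgesIn_mono (Finset.subset_insert _ _) hf))
    refine mem_edgesIn.mpr ⟨(mem_edgesIn.mp hf).1, fun w hw => ?_⟩
    have h1 := (mem_edgesIn.mp hf).2 w hw
    rw [Finset.mem_insert, mem_rightSide] at h1 ⊢
    exact h1.imp_right fun h1 => ⟨(mem_edgesIn.mp hfY).2 w hw, h1.2⟩
  have hle := Finset.card_le_card hE
  have heq := Finset.eq_of_subset_of_card_le hbe (by lia)
  intro hab
  rw [← heq, mem_rightSide] at hab
  exact (Finset.notMem_erase _ _) hab.1

end WingChoice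

theorem WingChoice.isLeaf {H : Finset (Sym2 Pt)} {X : Finset Pt} {A B : Pt → Finset Pt}
    {s p : Pt → Pt} {x y : Pt} (h : WingChoice H X A B s p) (hx : x ∈ branchPoints H X)
    (hxy : s(x, y) ∈ edgesIn H X) (hy : ¬ IsExt X y) : IsLeaf H X s p x y where
  mem := hx
  edge := hxy
  ne_s := fun he => hy (he ▸ (h.wings x hx).hull_s.isExt_right)
  ne_p := fun he => hy (he ▸ (h.wings x hx).hull_p.isExt_left)

theorem WingChoice.exists_isLeaf {H : Finset (Sym2 Pt)} {X : Finset Pt} {A B : Pt → Finset Pt}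
    {s p : Pt → Pt} {u w : Pt} (h : WingChoice H X A B s p) (hu : u ∈ branchPoints H X)
    (hw : Touched H X w) (hwX : ¬ IsExt X w) : ∃ x, IsLeaf H X s p x w := by
  have hS : ∀ f ∈ edgesIn H X, ∀ a ∈ f,
      a ∈ {w | w ∈ branchPoints H X ∨ ∃ x ∈ branchPoints H X, s(x, w) ∈ edgesIn H X} →
      ∀ w ∈ f, w ∈ {w | w ∈ branchPoints H X ∨
        ∃ x ∈ branchPoints H X, s(x, w) ∈ edgesIn H X} := by
    intro f hf a ha haS w hw
    obtain ⟨b, rfl⟩ := Sym2.mem_iff_exists.mp ha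
    rcases haS with haE | ⟨x, hx, hxa⟩
    · rcases Sym2.mem_iff.mp hw with rfl | rfl
      · exact Or.inl haE
      · exact Or.inr ⟨a, haE, hf⟩
    · rcases Sym2.mem_iff.mp hw with rfl | rfl
      · exact Or.inr ⟨x, hx, hxa⟩
      by_cases hxb : s(a, w) = s(x, a)
      · obtain rfl : w = x := by rw [Sym2.eq_swap] at hxb; exact Sym2.congr_left.mp hxb
        exact Or.inl hx
      by_cases hae : IsExt X a
      · exact Or.inr ⟨a, ⟨hae, _, hf, _, hxa, hxb, ha, by simp⟩, hf⟩
      · exact absurd (h.eq_of_mem (h.isLeaf hx hxa hae) hf ha) hxb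
  obtain ⟨f, hf, hwf⟩ := hw
  rcases h.system.conn _ fun f hf => (by
    by_cases hex : ∃ a ∈ f, a ∈ {w | w ∈ branchPoints H X ∨
        ∃ x ∈ branchPoints H X, s(x, w) ∈ edgesIn H X}
    · obtain ⟨a, ha, haS⟩ := hex
      exact Or.inl (hS f hf a ha haS)
    · push Not at hex
      exact Or.inr hex) with hall | hno
  · rcases hall f hf w hwf with hw | ⟨x, hx, hxw⟩
    · exact absurd hw.1 hwX
    · exact ⟨x, h.isLeaf hx hxw hwX⟩
  · exact absurd (Or.inl hu) (hno _ (h.system.edge_s u hu) u (by simp))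

open Classical in
theorem Blocker.card_isExt_of_mem {H : Finset (Sym2 Pt)} {X : Finset Pt} {u v : Pt} {m : ℕ}
    (hb : Blocker H X m) (hu : u ∈ branchPoints H X) (hv : IsExt X v)
    (huv : s(u, v) ∈ edgesIn H X) (h1 : ¬ HullEdge X u v) (h2 : ¬ HullEdge X v u) :
    m + 2 ≤ (X.filter (IsExt X)).card := by
  obtain ⟨A, B, s, p, h⟩ := hb.exists_wingChoice
  have hvl : IsLeaf H X s p u v :=
    ⟨hu, huv, fun he => h1 (he ▸ (h.wings u hu).hull_s), fun he => h2 (he ▸ (h.wings u hu).hull_p)⟩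
  have hexit : ∀ y, (∃ x, IsLeaf H X s p x y) → ∃ a, IsExt X a ∧ ¬ Touched H X a ∧
      ∃ x, IsLeaf H X s p x y ∧ a ∈ rightSide X x y ∧
        ∃ k, Blocker H ((insert x (rightSide X x y)).erase a) k := by
    rintro y ⟨x, hl⟩
    obtain ⟨a, ha, hae, hat, hk⟩ := (h.wings x hl.mem).leaf_exit y hl.edge hl.ne_s hl.ne_p
    exact ⟨a, hae, hat, x, hl, ha, hk⟩
  choose! g hge hgt hgl using hexit
  set L := X.filter fun y => ∃ x, IsLeaf H X s p x y with hL
  have hmemL : ∀ {x y}, IsLeaf H X s p x y → y ∈ L := fun hl =>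
    Finset.mem_filter.mpr ⟨(mk_mem_edgesIn.mp hl.edge).2.2, _, hl⟩
  have hinj : Set.InjOn g L := by
    intro y hy y' hy' he
    by_contra hne
    obtain ⟨x, hl, ha, k, hk⟩ := hgl y (Finset.mem_filter.mp hy).2
    obtain ⟨x', hl', ha', k', hk'⟩ := hgl y' (Finset.mem_filter.mp hy').2
    have ht := hgt y (Finset.mem_filter.mp hy).2
    have ht' := hgt y' (Finset.mem_filter.mp hy').2
    rcases h.nested_or hb.gp hb.diag hl hl' hne with hn | hn
    · exact h.notMem_rightSide_of_nested hb hl hl' hn ht' hk' (he ▸ ha)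
    · exact h.notMem_rightSide_of_nested hb hl' hl hn ht hk (he ▸ ha')
  obtain ⟨V, hV, hVc⟩ := hb.connected_and_card.2
  have hsub : insert v (V.filter fun w => ¬ IsExt X w) ⊆ L := by
    intro w hw
    rw [Finset.mem_insert, Finset.mem_filter] at hw
    rcases hw with rfl | hw
    · exact hmemL hvl
    · obtain ⟨x, hl⟩ := h.exists_isLeaf hu (hV w hw.1).2 hw.2
      exact hmemL hl
  have hdisj : Disjoint (V.filter (IsExt X)) (L.image g) := by
    rw [Finset.disjoint_left]
    intro w hw hw'
    obtain ⟨y, hy, rfl⟩ := Finset.mem_image.mp hw'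
    exact hgt y (Finset.mem_filter.mp hy).2 (hV _ (Finset.mem_filter.mp hw).1).2
  have hsub' : V.filter (IsExt X) ∪ L.image g ⊆ X.filter (IsExt X) := by
    intro w hw
    rcases Finset.mem_union.mp hw with hw | hw
    · exact Finset.mem_filter.mpr
        ⟨(hV w (Finset.mem_filter.mp hw).1).1, (Finset.mem_filter.mp hw).2⟩
    · obtain ⟨y, hy, rfl⟩ := Finset.mem_image.mp hw
      have := hge y (Finset.mem_filter.mp hy).2
      exact Finset.mem_filter.mpr ⟨this.1, this⟩
  have c1 := Finset.card_le_card hsub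
  rw [Finset.card_insert_of_notMem (by simp [hv])] at c1
  have c2 := Finset.card_le_card hsub'
  rw [Finset.card_union_of_disjoint hdisj, Finset.card_image_of_injOn hinj] at c2
  have c3 := Finset.card_filter_add_card_filter_not (s := V) (IsExt X)
  lia

open Classical in
/-- If an edge of a blocker joins two extreme points that are not consecutive on the hull, then
there are at least `m + 2` extreme points. -/
theorem Blocker.card_isExt {H : Finset (Sym2 Pt)} {X : Finset Pt} {u v : Pt} {m : ℕ}
    (hb : Blocker H X m) (hm : 2 ≤ m) (hu : IsExt X u) (hv : IsExt X v)
    (huv : s(u, v) ∈ edgesIn H X) (h1 : ¬ HullEdge X u v) (h2 : ¬ HullEdge X v u) :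
    m + 2 ≤ (X.filter (IsExt X)).card := by
  rcases hb.branching_or hm hu huv h1 h2 with hbr | hbr
  · exact hb.card_isExt_of_mem ⟨hu, hbr⟩ hv huv h1 h2
  · exact hb.card_isExt_of_mem ⟨hv, hbr⟩ hu (Sym2.eq_swap ▸ huv) h2 h1

theorem IsExt.mem_extremePoints {X : Finset Pt} {x : Pt} (h : IsExt X x) :
    x ∈ Set.extremePoints ℝ (convexHull ℝ (X : Set Pt)) := by
  obtain ⟨hx, c, hc⟩ := h
  have key : ∀ z ∈ convexHull ℝ (X : Set Pt),
      z = x ∨ 0 < c.1 * (z.1 - x.1) + c.2 * (z.2 - x.2) := by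
    refine fun z hz => convexHull_min (t := {z : Pt | z = x ∨
      0 < c.1 * (z.1 - x.1) + c.2 * (z.2 - x.2)}) (fun w hw => or_iff_not_imp_left.mpr (hc w hw))
      ?_ hz
    intro a ha b hb α β hα hβ hαβ
    obtain rfl : β = 1 - α := by linarith
    simp only [Set.mem_ofPred_eq, Prod.fst_add, Prod.snd_add, Prod.smul_fst, Prod.smul_snd,
      smul_eq_mul] at ha hb ⊢
    rcases hα.eq_or_lt with rfl | hα
    · simpa using hb
    rcases hβ.eq_or_lt with h1 | hβ
    · obtain rfl : α = 1 := by linarith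
      simpa using ha
    rcases ha with rfl | ha <;> rcases hb with rfl | hb
    · left
      rw [← add_smul]
      simp
    · right
      nlinarith [mul_pos hβ hb]
    · right
      nlinarith [mul_pos hα ha]
    · right
      nlinarith [mul_pos hα ha, mul_pos hβ hb]
  rw [mem_extremePoints_iff_left]
  refine ⟨subset_convexHull ℝ _ hx, fun a ha b hb hab => ?_⟩
  refine (key a ha).resolve_right fun hpos => ?_
  obtain ⟨α, β, hα, hβ, hαβ, rfl⟩ := hab
  obtain rfl : β = 1 - α := by linarith
  have hb' := key b hb
  simp only [Prod.fst_add, Prod.snd_add, Prod.smul_fst, Prod.smul_snd, smul_eq_mul] at hpos hb'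
  rcases hb' with hb' | hb'
  · have e1 := congrArg Prod.fst hb'
    have e2 := congrArg Prod.snd hb'
    simp only [Prod.fst_add, Prod.snd_add, Prod.smul_fst, Prod.smul_snd, smul_eq_mul] at e1 e2
    have f1 : a.1 = b.1 := mul_left_cancel₀ hα.ne' (by linarith)
    have f2 : a.2 = b.2 := mul_left_cancel₀ hα.ne' (by linarith)
    rw [f1, f2] at hpos
    ring_nf at hpos
    exact lt_irrefl _ hpos
  · nlinarith [mul_pos hα hpos, mul_pos hβ hb']

theorem isExt_of_mem_extremePoints {X : Finset Pt} {x : Pt}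
    (h : x ∈ Set.extremePoints ℝ (convexHull ℝ (X : Set Pt))) : IsExt X x := by
  have hx : x ∈ X := extremePoints_convexHull_subset h
  have hn : x ∉ convexHull ℝ ((X : Set Pt) \ {x}) := by
    rw [(convex_convexHull ℝ _).mem_extremePoints_iff_mem_sdiff_convexHull_sdiff] at h
    exact fun hx' => h.2 (convexHull_mono (Set.sdiff_subset_sdiff_left (subset_convexHull ℝ _)) hx')
  have hfin : ((X : Set Pt) \ {x}).Finite := X.finite_toSet.sdiff
  obtain ⟨φ, r, hr, hφ⟩ := geometric_hahn_banach_point_closed (convex_convexHull ℝ _)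
    (hfin.isClosed_convexHull ℝ) hn
  refine ⟨hx, (φ (1, 0), φ (0, 1)), fun w hw hne => ?_⟩
  have hlin : ∀ z : Pt, φ z = z.1 * φ (1, 0) + z.2 * φ (0, 1) := fun z => by
    conv_lhs => rw [show z = z.1 • ((1, 0) : Pt) + z.2 • ((0, 1) : Pt) by ext <;> simp]
    rw [map_add, map_smul, map_smul, smul_eq_mul, smul_eq_mul]
  have := hφ w (subset_convexHull ℝ _ ⟨hw, hne⟩)
  rw [hlin] at hr this
  dsimp only
  linarith

/-- if at most `n+1` points of `X` are extreme points of its convex hull and `H`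
is a set of exactly `n` edges eliminating all non-crossing perfect matchings, then every edge of
`H` joining two extreme points is a boundary edge of the convex hull, i.e. all other points of
`X` lie strictly on one side of the line through its endpoints. -/
theorem hull_edge_is_boundary_edge (n : ℕ) (X : Finset Pt)
    (hXcard : X.card = 2 * n) (hgp : GenPos X)
    (hhull : ((X : Set Pt) ∩ Set.extremePoints ℝ (convexHull ℝ (X : Set Pt))).ncard ≤ n + 1)
    (H : Finset (Sym2 Pt)) (hH : ∀ e ∈ H, IsEdgeOf X e) (hHcard : H.card = n)
    (helim : ∀ M : Finset (Sym2 Pt), IsNCMatching X M → ¬ Avoids M H)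
    (u v : Pt) (huv : s(u, v) ∈ H)
    (hu : u ∈ Set.extremePoints ℝ (convexHull ℝ (X : Set Pt)))
    (hv : v ∈ Set.extremePoints ℝ (convexHull ℝ (X : Set Pt))) :
    (∀ w ∈ X, w ≠ u → w ≠ v → 0 < cross u v w) ∨
    (∀ w ∈ X, w ≠ u → w ≠ v → cross u v w < 0) := by
  classical
  have hu' := isExt_of_mem_extremePoints hu
  have hv' := isExt_of_mem_extremePoints hv
  have hne : u ≠ v := by simpa using (hH _ huv).1
  have hHX : edgesIn H X = H :=
    Finset.filter_true_of_mem fun e he => (hH e he).2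
  by_contra hcon
  have h1 : ¬ HullEdge X u v := fun h => hcon (Or.inl h.2.2.2)
  have h2 : ¬ HullEdge X v u := fun h => hcon (Or.inr fun w hw hwu hwv => by
    have := h.2.2.2 w hw hwv hwu
    rw [cross_swap] at this
    linarith)
  have hn : 2 ≤ n := by
    by_contra! hlt
    have hX : {u, v} = X := Finset.eq_of_subset_of_card_le
      (by simp [Finset.insert_subset_iff, hu'.1, hv'.1]) (by rw [Finset.card_pair hne]; lia)
    refine hcon (Or.inl fun w hw hwu hwv => ?_)
    rw [← hX] at hw
    simp [hwu, hwv] at hw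
  have hb : Blocker H X n := {
    diag := fun e he => (hH e he).1
    gp := hgp
    card := hXcard
    edges := hHX.symm ▸ hHcard
    notMatchable := fun ⟨M, hM, hMH⟩ => helim M hM hMH }
  have hc := hb.card_isExt hn hu' hv' (hHX.symm ▸ huv) h1 h2
  have hsub : ((X.filter (IsExt X) : Finset Pt) : Set Pt) ⊆
      (X : Set Pt) ∩ Set.extremePoints ℝ (convexHull ℝ (X : Set Pt)) := fun w hw => by
    have hw := Finset.mem_filter.mp hw
    exact ⟨hw.1, hw.2.mem_extremePoints⟩
  have := Set.ncard_le_ncard hsub (X.finite_toSet.inter_of_left _)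
  rw [Set.ncard_coe_finset] at this
  lia
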